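/- Let q ≥ 7 be a prime power, F a finite field with q^2 elements, and G ∈ F[x_0,...,x_4] a nonzero homogeneous polynomial of degree 3. Then |V(G)(F) ∩ V_3| ≤ 3(q^5 + q^2) + q^3 + 1. -/

import Mathlib

open MvPolynomial

noncomputable section

/-- The projective space ℙ⁴(F): 1-dimensional F-linear subspaces of F⁵. -/
abbrev P4 (F : Type) [Field F] := Projectivization F (Fin 5 → F)

/-- The non-degenerate Hermitian threefold
    V₃ = {[x] ∈ ℙ⁴(F) : x₀^{q+1} + ⋯ + x₄^{q+1} = 0}. -/
def hermV3 (q : ℕ) (F : Type) [Field F] : Set (P4 F) :=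
  {x | ∑ i, x.rep i ^ (q + 1) = 0}

/-- V(G)(F) = {[x] ∈ ℙ⁴(F) : G(x) = 0}, for G homogeneous this is well defined. -/
def VG {F : Type} [Field F] (G : MvPolynomial (Fin 5) F) : Set (P4 F) :=
  {x | eval x.rep G = 0}

/-- The set of points of ℙ⁴(F) contained in an F-linear subspace of F⁵ of dimension k. -/
def IsLinSub (F : Type) [Field F] (k : ℕ) (S : Set (P4 F)) : Prop :=
  ∃ W : Submodule F (Fin 5 → F), Module.finrank F W = k ∧
    S = {x : P4 F | x.submodule ≤ W}

/-- A line of ℙ⁴(F). -/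
def IsLine (F : Type) [Field F] (S : Set (P4 F)) : Prop := IsLinSub F 2 S

/-- A plane of ℙ⁴(F). -/
def IsPlane (F : Type) [Field F] (S : Set (P4 F)) : Prop := IsLinSub F 3 S

/-- A hyperplane of ℙ⁴(F). -/
def IsHyperplane (F : Type) [Field F] (S : Set (P4 F)) : Prop := IsLinSub F 4 S

/-- The tangent hyperplane T_P(V₃) = {[x] : a₀^q x₀ + ⋯ + a₄^q x₄ = 0} where P = [a]. -/
def tangentHyp (q : ℕ) {F : Type} [Field F] (P : P4 F) : Set (P4 F) :=
  {x | ∑ i, P.rep i ^ q * x.rep i = 0}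

/-- A subset of ℙ⁴(F) is a tangent hyperplane to V₃ if it equals T_P(V₃) for some P ∈ V₃. -/
def IsTangentHyp (q : ℕ) {F : Type} [Field F] (S : Set (P4 F)) : Prop :=
  ∃ P ∈ hermV3 q F, S = tangentHyp q P

namespace HermitianCubic

open Finset Module

open scoped Classical

/-- `F` is a field with `q ^ 2` elements on which `x ↦ x ^ q` is additive. -/
class HermField (q : ℕ) (F : Type) [Field F] [Fintype F] : Prop where
  card : Fintype.card F = q ^ 2
  add_pow : ∀ x y : F, (x + y) ^ q = x ^ q + y ^ q
  seven_le : 7 ≤ q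

/-- The coordinate space `F ^ 5`. -/
abbrev V5 (F : Type) := Fin 5 → F

/-- The number of elements satisfying a predicate, as an integer. -/
def cnt {α : Type} [Fintype α] (P : α → Prop) : ℤ := ((univ.filter P).card : ℤ)

section Counting

variable {α β : Type} [Fintype α] [Fintype β]

lemma cnt_eq_sum (P : α → Prop) : cnt P = ∑ x, if P x then (1 : ℤ) else 0 := by
  simp [cnt]

lemma cnt_nonneg (P : α → Prop) : 0 ≤ cnt P := by simp [cnt]

lemma cnt_mono {P Q : α → Prop} (h : ∀ x, P x → Q x) : cnt P ≤ cnt Q := by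
  unfold cnt
  exact_mod_cast card_le_card (monotone_filter_right _ fun x _ => h x)

lemma cnt_congr {P Q : α → Prop} (h : ∀ x, P x ↔ Q x) : cnt P = cnt Q := by
  congr 1; ext x; exact h x

lemma cnt_split (P Q : α → Prop) :
    cnt P = cnt (fun x => P x ∧ Q x) + cnt (fun x => P x ∧ ¬ Q x) := by
  simp only [cnt_eq_sum, ← sum_add_distrib]
  refine sum_congr rfl fun x _ => ?_
  by_cases h : P x <;> by_cases h' : Q x <;> simp [h, h']

lemma cnt_or_le (P Q : α → Prop) : cnt (fun x => P x ∨ Q x) ≤ cnt P + cnt Q := by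
  simp only [cnt_eq_sum, ← sum_add_distrib]
  refine sum_le_sum fun x _ => ?_
  by_cases h : P x <;> by_cases h' : Q x <;> simp [h, h']

lemma cnt_bij {P : α → Prop} {Q : β → Prop} (i : α → β) (j : β → α)
    (hi : ∀ a, P a → Q (i a)) (hj : ∀ b, Q b → P (j b))
    (hji : ∀ a, P a → j (i a) = a) (hij : ∀ b, Q b → i (j b) = b) : cnt P = cnt Q := by
  unfold cnt
  exact_mod_cast card_nbij' i j (fun a ha => by simp_all) (fun a ha => by simp_all)
    (fun a ha => by simp_all) (fun a ha => by simp_all)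

/-- Counting the pairs of a relation in two ways. -/
lemma sum_cnt_comm (P : α → β → Prop) :
    ∑ a, cnt (fun b => P a b) = ∑ b, cnt (fun a => P a b) := by
  simp only [cnt_eq_sum]
  exact sum_comm

lemma cnt_pair (P : α → β → Prop) :
    cnt (fun x : α × β => P x.1 x.2) = ∑ a, cnt (fun b => P a b) := by
  simp only [cnt_eq_sum, Fintype.sum_prod_type]

lemma cnt_le_of_surj {P : α → Prop} {Q : β → Prop} (j : β → α)
    (h : ∀ a, P a → ∃ b, Q b ∧ j b = a) : cnt P ≤ cnt Q := by
  unfold cnt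
  have : univ.filter P ⊆ (univ.filter Q).image j := by
    intro a ha
    obtain ⟨b, hb, rfl⟩ := h a (by simpa using ha)
    exact mem_image_of_mem _ (by simpa using hb)
  exact_mod_cast (card_le_card this).trans card_image_le

lemma sum_ite_const_eq (P : α → Prop) (c : ℤ) : (∑ x, if P x then c else 0) = cnt P * c := by
  rw [← sum_filter, sum_const, cnt, nsmul_eq_mul]

end Counting

section Field

lemma cnt_pow_eq_le {F : Type} [Field F] [Fintype F] (n : ℕ) (hn : 0 < n) (a : F) :
    cnt (fun t : F => t ^ n = a) ≤ n := by
  unfold cnt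
  have : univ.filter (fun t : F => t ^ n = a) ⊆ (Polynomial.nthRoots n a).toFinset := by
    intro t ht
    simpa [Polynomial.mem_nthRoots hn] using ht
  exact_mod_cast (card_le_card this).trans
    ((Multiset.toFinset_card_le _).trans (Polynomial.card_nthRoots n a))

variable {q : ℕ} {F : Type} [Field F] [Fintype F] [hq : HermField q F]

include hq

lemma q_pos : 0 < q := by have := hq.seven_le; omega

lemma zero_pow_q : (0 : F) ^ q = 0 := zero_pow (q_pos (F := F)).ne'

lemma pow_q_pow_q (x : F) : (x ^ q) ^ q = x := by
  rw [← pow_mul, ← sq, ← hq.card, FiniteField.pow_card]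

lemma sum_pow_q {ι : Type} (s : Finset ι) (f : ι → F) :
    (∑ i ∈ s, f i) ^ q = ∑ i ∈ s, f i ^ q := by
  induction s using Finset.induction_on with
  | empty => simpa using zero_pow_q (q := q) (F := F)
  | insert a s ha ih => rw [sum_insert ha, sum_insert ha, hq.add_pow, ih]

lemma card_fin : Fintype.card F = q ^ 2 := hq.card

lemma neg_pow_q (x : F) : (-x) ^ q = -x ^ q := by
  have := hq.add_pow x (-x)
  rw [add_neg_cancel, zero_pow_q] at this
  exact (neg_eq_of_add_eq_zero_right this.symm).symm

lemma norm_mem (t : F) : (t ^ (q + 1)) ^ q = t ^ (q + 1) := by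
  rw [pow_succ, mul_pow, pow_q_pow_q, mul_comm]

lemma cnt_norm_eq {a : F} (ha : a ≠ 0) (haq : a ^ q = a) :
    cnt (fun t : F => t ^ (q + 1) = a) = q + 1 := by
  have h7 := hq.seven_le
  have hK : ∀ b : F, b ≠ 0 → b ^ q = b → b ^ (q - 1) = 1 := by
    intro b hb hbq
    have : b ^ (q - 1) * b = 1 * b := by
      rw [← pow_succ, Nat.sub_add_cancel (by omega), hbq, one_mul]
    exact mul_right_cancel₀ hb this
  have hsum : ∑ b : F, cnt (fun t : F => t ≠ 0 ∧ t ^ (q + 1) = b) = (q : ℤ) ^ 2 - 1 := by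
    rw [sum_cnt_comm]
    have h1 : ∀ t : F, cnt (fun b : F => t ≠ 0 ∧ t ^ (q + 1) = b) = if t ≠ 0 then 1 else 0 := by
      intro t
      by_cases ht : t = 0
      · simp [ht, cnt]
      · simp [ht, cnt, Finset.filter_eq]
    simp only [h1]
    have h2 := cnt_split (fun _ : F => True) (fun t => t = 0)
    have h3 : cnt (fun _ : F => True) = (q : ℤ) ^ 2 := by simp [cnt, hq.card]
    have h4 : cnt (fun t : F => True ∧ t = 0) = 1 := by
      rw [cnt_eq_sum]; simp
    have h5 : cnt (fun t : F => True ∧ ¬ t = 0) = ∑ t : F, if t ≠ 0 then (1 : ℤ) else 0 := by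
      rw [cnt_eq_sum]; simp only [true_and, ne_eq]
    linarith
  have hle : ∀ b : F, cnt (fun t : F => t ≠ 0 ∧ t ^ (q + 1) = b) ≤
      if b ^ (q - 1) = 1 then (q : ℤ) + 1 else 0 := by
    intro b
    split_ifs with hb
    · refine (cnt_mono (Q := fun t : F => t ^ (q + 1) = b) fun t ht => ht.2).trans ?_
      exact_mod_cast cnt_pow_eq_le (q + 1) (by omega) b
    · apply le_of_eq
      have : ∀ t : F, ¬ (t ≠ 0 ∧ t ^ (q + 1) = b) := by
        rintro t ⟨ht, rfl⟩
        exact hb (hK _ (pow_ne_zero _ ht) (norm_mem t))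
      simp only [cnt, this]; simp
  have hcard : (∑ b : F, if b ^ (q - 1) = 1 then (q : ℤ) + 1 else 0) ≤ (q - 1) * (q + 1) := by
    rw [sum_ite_const_eq]
    have := cnt_pow_eq_le (F := F) (q - 1) (by omega) 1
    push_cast [Nat.cast_sub (show 1 ≤ q by omega)] at this
    exact mul_le_mul_of_nonneg_right this (by positivity)
  have heq : cnt (fun t : F => t ≠ 0 ∧ t ^ (q + 1) = a) =
      if a ^ (q - 1) = 1 then (q : ℤ) + 1 else 0 := by
    by_contra hne
    have hlt := lt_of_le_of_ne (hle a) hne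
    have := sum_lt_sum (fun b _ => hle b) ⟨a, mem_univ a, hlt⟩
    rw [hsum] at this
    nlinarith
  rw [if_pos (hK a ha haq)] at heq
  rw [← heq]
  apply cnt_congr
  intro t
  refine ⟨fun h => ⟨?_, h⟩, fun h => h.2⟩
  rintro rfl
  exact ha (by rw [← h]; simp)

end Field

section Subspace

variable {F : Type} [Field F]

lemma finrank_inf_ker (U : Submodule F (V5 F)) (φ : V5 F →ₗ[F] F) {v : V5 F} (hv : v ∈ U)
    (h : φ v ≠ 0) : finrank F (U ⊓ LinearMap.ker φ : Submodule F (V5 F)) + 1 = finrank F U := by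
  have h1 : (φ.domRestrict U) ≠ 0 := by
    intro h0
    exact h (LinearMap.congr_fun h0 ⟨v, hv⟩)
  have h2 := Module.Dual.finrank_ker_add_one_of_ne_zero h1
  have h3 : U ⊓ LinearMap.ker φ = (LinearMap.ker (φ.domRestrict U)).map U.subtype := by
    ext x
    simp [Submodule.mem_map]
    tauto
  rw [← h2, h3, Submodule.finrank_map_subtype_eq]

lemma cnt_mem {q : ℕ} [Fintype F] [HermField q F] (U : Submodule F (V5 F)) :
    cnt (fun x => x ∈ U) = (q : ℤ) ^ (2 * finrank F U) := by
  unfold cnt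
  rw [← Fintype.card_subtype]
  have := Module.card_eq_pow_finrank (K := F) (V := U)
  rw [card_fin (q := q) (F := F), ← pow_mul] at this
  exact_mod_cast (by convert this)

end Subspace

section Herm

variable (q : ℕ) {F : Type} [Field F]

/-- The Hermitian form `∑ x_i y_i ^ q`, as a linear functional of `x`. -/
def herm (y : V5 F) : V5 F →ₗ[F] F where
  toFun x := ∑ i, x i * y i ^ q
  map_add' x x' := by simp [add_mul, sum_add_distrib]
  map_smul' c x := by simp [mul_sum, mul_assoc]

/-- Isotropic vectors. -/
def Iso (x : V5 F) : Prop := herm q x x = 0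

lemma iso_zero : Iso q (0 : V5 F) := by simp [Iso]

variable [Fintype F]

/-- The number of isotropic vectors in a subspace. -/
def iso (U : Submodule F (V5 F)) : ℤ := cnt fun x => x ∈ U ∧ Iso q x

variable {q} [hq : HermField q F]

include hq

lemma herm_conj (x y : V5 F) : herm q y x = (herm q x y) ^ q := by
  simp only [herm, LinearMap.coe_mk, AddHom.coe_mk]
  rw [sum_pow_q]
  refine sum_congr rfl fun i _ => ?_
  rw [mul_pow, pow_q_pow_q, mul_comm]

lemma herm_symm {x y : V5 F} : herm q y x = 0 ↔ herm q x y = 0 := by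
  rw [herm_conj]
  exact pow_eq_zero_iff (q_pos (F := F)).ne'

lemma herm_add_right (x y y' : V5 F) : herm q (y + y') x = herm q y x + herm q y' x := by
  rw [herm_conj x, herm_conj x y, herm_conj x y', map_add, hq.add_pow]

lemma herm_smul_right (c : F) (x y : V5 F) : herm q (c • y) x = c ^ q * herm q y x := by
  rw [herm_conj x, herm_conj x y, map_smul, smul_eq_mul, mul_pow]

lemma herm_zero_right (x : V5 F) : herm q 0 x = 0 := by
  rw [herm_symm, map_zero]

lemma herm_self_pow (x : V5 F) : (herm q x x) ^ q = herm q x x := (herm_conj x x).symm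

lemma iso_smul (c : F) {x : V5 F} (h : Iso q x) : Iso q (c • x) := by
  unfold Iso at *
  rw [herm_smul_right, map_smul, h]; simp

lemma herm_add_self (x y : V5 F) :
    herm q (x + y) (x + y) = herm q x x + herm q x y + herm q y x + herm q y y := by
  rw [herm_add_right, map_add, map_add]; ring

lemma iso_add {x y : V5 F} (hx : Iso q x) (hy : Iso q y) (h : herm q x y = 0) :
    Iso q (x + y) := by
  unfold Iso at *
  rw [herm_add_self, hx, hy, h, herm_symm.2 h]; simp

lemma iso_comb {x y : V5 F} (hx : Iso q x) (hy : Iso q y) (h : herm q x y = 0) (s t : F) :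
    Iso q (s • x + t • y) := by
  refine iso_add (iso_smul s hx) (iso_smul t hy) ?_
  rw [herm_smul_right, map_smul, h]; simp

/-- Every functional is represented by the Hermitian form. -/
lemma exists_herm_eq (φ : V5 F →ₗ[F] F) : ∃ a, φ = herm q a := by
  refine ⟨fun i => φ (Pi.single i 1) ^ q, ?_⟩
  apply LinearMap.pi_ext'
  intro i
  ext
  simp only [LinearMap.coe_comp, Function.comp_apply, LinearMap.coe_single, herm,
    LinearMap.coe_mk, AddHom.coe_mk, pow_q_pow_q]
  rw [Finset.sum_eq_single i]
  · simp
  · intro j _ hj; simp [Pi.single_eq_of_ne hj]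
  · simp

lemma herm_injective {a b : V5 F} (h : herm q a = herm q b) : a = b := by
  ext i
  have := LinearMap.congr_fun h (Pi.single i 1)
  simp only [herm, LinearMap.coe_mk, AddHom.coe_mk] at this
  rw [Finset.sum_eq_single i (by intro j _ hj; simp [Pi.single_eq_of_ne hj]) (by simp),
    Finset.sum_eq_single i (by intro j _ hj; simp [Pi.single_eq_of_ne hj]) (by simp)] at this
  simp only [Pi.single_eq_same, one_mul] at this
  rw [← pow_q_pow_q (q := q) (a i), this, pow_q_pow_q]

lemma herm_eq_zero {a : V5 F} : herm q a = 0 ↔ a = 0 := by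
  constructor
  · intro h
    apply herm_injective (q := q)
    rw [h]; ext x; simp [herm_zero_right]
  · rintro rfl; ext x; simp [herm_zero_right]

end Herm

section IsoFormula

variable {q : ℕ} {F : Type} [Field F]

/-- The hyperplane orthogonal to `a`. -/
def perp (q : ℕ) {F : Type} [Field F] (a : V5 F) : Submodule F (V5 F) := LinearMap.ker (herm q a)

/-- The radical of a subspace. -/
def rad (q : ℕ) {F : Type} [Field F] (U : Submodule F (V5 F)) : Submodule F (V5 F) :=
  U ⊓ ⨅ y : U, perp q (y : V5 F)

lemma mem_perp {a x : V5 F} : x ∈ perp q a ↔ herm q a x = 0 := Iff.rfl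

lemma mem_rad {U : Submodule F (V5 F)} {x : V5 F} :
    x ∈ rad q U ↔ x ∈ U ∧ ∀ y ∈ U, herm q y x = 0 := by
  simp [rad, mem_perp]

variable [Fintype F] [hq : HermField q F]

include hq

lemma q_ge : (7 : ℤ) ≤ q := by exact_mod_cast hq.seven_le

lemma herm_eq_zero_of_forall_iso {U : Submodule F (V5 F)} (hU : ∀ x ∈ U, Iso q x) {x y : V5 F}
    (hx : x ∈ U) (hy : y ∈ U) : herm q x y = 0 := by
  by_contra hc
  set c := herm q x y with hcdef
  have key : ∀ t : F, t * c + t ^ q * c ^ q = 0 := by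
    intro t
    have h1 := hU _ (U.add_mem hx (U.smul_mem t hy))
    have hx0 := hU _ hx
    have hy0 := iso_smul t (hU _ hy)
    unfold Iso at h1 hx0 hy0
    rw [herm_add_self, hx0, hy0, map_smul, herm_smul_right, herm_conj x y] at h1
    simpa using h1
  have h2 : ∀ t : F, t ≠ 0 → t ^ (q - 1) = - c / c ^ q := by
    intro t ht
    have h7 := hq.seven_le
    have h3 := key t
    have h4 : t ^ q = t ^ (q - 1) * t := by rw [← pow_succ, Nat.sub_add_cancel (by omega)]
    rw [h4] at h3
    have h5 : t * (c + t ^ (q - 1) * c ^ q) = 0 := by linear_combination h3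
    rw [eq_div_iff (pow_ne_zero _ hc)]
    linear_combination (mul_eq_zero.1 h5).resolve_left ht
  have h7 := q_ge (q := q) (F := F)
  have h8 := cnt_pow_eq_le (F := F) (q - 1) (by have := hq.seven_le; omega) (-c / c ^ q)
  have h9 := cnt_mono h2
  have h10 := cnt_split (fun _ : F => True) (fun t => t = 0)
  have h11 : cnt (fun _ : F => True) = (q : ℤ) ^ 2 := by simp [cnt, hq.card]
  have h12 : cnt (fun t : F => True ∧ t = 0) = 1 := by
    rw [cnt_eq_sum]; simp
  simp only [true_and] at h10 h12
  push_cast [Nat.cast_sub (show 1 ≤ q by have := hq.seven_le; omega)] at h8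
  rw [h11, h12] at h10
  simp only [ne_eq] at h9
  nlinarith

lemma rad_inf_perp {U : Submodule F (V5 F)} {v : V5 F} (hv : v ∈ U) (hN : herm q v v ≠ 0) :
    rad q (U ⊓ perp q v) = rad q U := by
  ext x
  simp only [mem_rad, Submodule.mem_inf, mem_perp]
  constructor
  · rintro ⟨⟨hxU, hvx⟩, h⟩
    refine ⟨hxU, fun y hy => ?_⟩
    have := h (y - (herm q v y / herm q v v) • v) ⟨U.sub_mem hy (U.smul_mem _ hv), by
      rw [map_sub, map_smul, smul_eq_mul, div_mul_cancel₀ _ hN, sub_self]⟩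
    have h2 : y = (y - (herm q v y / herm q v v) • v) + (herm q v y / herm q v v) • v := by simp
    rw [h2, herm_add_right, this, herm_smul_right, hvx]; simp
  · rintro ⟨hxU, h⟩
    exact ⟨⟨hxU, h v hv⟩, fun y hy => h y hy.1⟩

lemma iso_step {U : Submodule F (V5 F)} {v : V5 F} (hv : v ∈ U) (hN : herm q v v ≠ 0) :
    iso q U = (q + 1) * (q : ℤ) ^ (2 * finrank F (U ⊓ perp q v : Submodule F (V5 F)))
      - q * iso q (U ⊓ perp q v) := by
  have h1 : iso q U = cnt (fun p : V5 F × F => p.1 ∈ U ⊓ perp q v ∧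
      herm q v v * p.2 ^ (q + 1) + herm q p.1 p.1 = 0) := by
    unfold iso
    have hN' : ∀ (t : F) (y : V5 F), y ∈ perp q v → herm q (y + t • v) (y + t • v) =
        herm q v v * t ^ (q + 1) + herm q y y := by
      intro t y hy
      rw [herm_add_self, map_smul, herm_smul_right, herm_symm.2 (mem_perp.1 hy),
        herm_smul_right, map_smul, mem_perp.1 hy]
      simp only [smul_eq_mul]; ring
    have hs : ∀ x : V5 F, x - (herm q v x / herm q v v) • v ∈ perp q v := by
      intro x
      rw [mem_perp, map_sub, map_smul, smul_eq_mul, div_mul_cancel₀ _ hN, sub_self]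
    refine cnt_bij (fun x => (x - (herm q v x / herm q v v) • v, herm q v x / herm q v v))
      (fun p => p.1 + p.2 • v) ?_ ?_ ?_ ?_
    · rintro x ⟨hx, hI⟩
      refine ⟨⟨U.sub_mem hx (U.smul_mem _ hv), hs x⟩, ?_⟩
      rw [← hN' _ _ (hs x), sub_add_cancel]; exact hI
    · rintro ⟨y, t⟩ ⟨⟨hy, hy'⟩, h⟩
      refine ⟨U.add_mem hy (U.smul_mem _ hv), ?_⟩
      unfold Iso
      rw [hN' _ _ hy']; exact h
    · intro x _; simp
    · rintro ⟨y, t⟩ ⟨⟨hy, hy'⟩, h⟩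
      have : herm q v (y + t • v) / herm q v v = t := by
        rw [map_add, mem_perp.1 hy', map_smul, smul_eq_mul, zero_add, mul_div_cancel_right₀ _ hN]
      exact Prod.ext (by simp only [this, add_sub_cancel_right]) this
  rw [h1, cnt_pair (fun (y : V5 F) (t : F) => y ∈ U ⊓ perp q v ∧
      herm q v v * t ^ (q + 1) + herm q y y = 0)]
  have h2 : ∀ y : V5 F, cnt (fun t : F => y ∈ U ⊓ perp q v ∧
      herm q v v * t ^ (q + 1) + herm q y y = 0) =
      (q + 1) * (if y ∈ U ⊓ perp q v then 1 else 0) -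
        q * (if y ∈ U ⊓ perp q v ∧ Iso q y then 1 else 0) := by
    intro y
    by_cases hy : y ∈ U ⊓ perp q v
    · by_cases hI : herm q y y = 0
      · have : Iso q y := hI
        simp only [hy, hI, true_and, add_zero, mul_eq_zero, hN, false_or]
        rw [cnt_eq_sum]; simp [this]
      · have : ¬ Iso q y := hI
        simp only [hy, this, true_and, if_true, if_false, and_false, mul_one, mul_zero, sub_zero]
        rw [← cnt_norm_eq (q := q) (a := - herm q y y / herm q v v)
          (div_ne_zero (neg_ne_zero.2 hI) hN)
          (by rw [div_pow, neg_pow_q, herm_self_pow, herm_self_pow])]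
        apply cnt_congr
        intro t
        rw [eq_div_iff hN, mul_comm, eq_neg_iff_add_eq_zero]
    · simp only [hy, false_and, if_false]
      simp [cnt]
  simp only [h2, sum_sub_distrib, ← mul_sum, ← cnt_eq_sum]
  rw [cnt_mem (q := q), iso, cnt_eq_sum]
  congr!

/-- The number of isotropic vectors of a subspace in terms of its dimension and radical. -/
lemma iso_formula (U : Submodule F (V5 F)) (n r : ℕ) (hn : finrank F U = n)
    (hr : finrank F (rad q U) = r) :
    (q : ℤ) * iso q U = q ^ (2 * n) + (-1) ^ (n + r) * (q - 1) * q ^ (n + r) := by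
  induction n generalizing U with
  | zero =>
    have hall : U = ⊥ := by rwa [Submodule.finrank_eq_zero] at hn
    subst hall
    have h0 : rad q (⊥ : Submodule F (V5 F)) = ⊥ := by
      rw [eq_bot_iff]; exact inf_le_left
    rw [h0, finrank_bot] at hr
    subst hr
    have : iso q (⊥ : Submodule F (V5 F)) = 1 := by
      have h1 := cnt_mem (q := q) (⊥ : Submodule F (V5 F))
      rw [finrank_bot] at h1
      simp only [mul_zero, pow_zero] at h1
      rw [← h1]
      refine cnt_congr fun x => ⟨fun h => h.1, fun h => ⟨h, ?_⟩⟩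
      rw [Submodule.mem_bot] at h
      rw [h]; exact iso_zero q
    rw [this]; simp
  | succ n ih =>
    by_cases hU : ∀ x ∈ U, Iso q x
    · have h1 : rad q U = U := by
        ext x
        rw [mem_rad]
        exact ⟨fun h => h.1, fun h => ⟨h, fun y hy => herm_eq_zero_of_forall_iso hU hy h⟩⟩
      rw [h1, hn] at hr
      subst hr
      have h2 : iso q U = (q : ℤ) ^ (2 * (n + 1)) := by
        rw [← hn, ← cnt_mem]
        exact cnt_congr fun x => ⟨fun h => h.1, fun h => ⟨h, hU x h⟩⟩
      rw [h2, show n + 1 + (n + 1) = 2 * (n + 1) by ring, pow_mul (-1 : ℤ)]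
      simp; ring
    · push Not at hU
      obtain ⟨v, hv, hN⟩ := hU
      have hN' : herm q v v ≠ 0 := hN
      have h1 := finrank_inf_ker U (herm q v) hv hN'
      have h2 : finrank F (U ⊓ perp q v : Submodule F (V5 F)) = n := by
        change finrank F (U ⊓ perp q v : Submodule F (V5 F)) + 1 = _ at h1
        omega
      have h3 := ih (U ⊓ perp q v) h2 (by rw [rad_inf_perp hv hN', hr])
      rw [iso_step hv hN', h2]
      linear_combination (-(q : ℤ)) * h3

lemma mem_span_singleton_of_perp {a x : V5 F} (h : ∀ y, herm q a y = 0 → herm q x y = 0) :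
    ∃ s : F, s • a = x := by
  have h1 := mem_span_of_iInf_ker_le_ker (ι := Unit) (L := fun _ => herm q a) (K := herm q x)
    (by intro y hy; exact h y (by simpa using hy))
  rw [Set.range_const, Submodule.mem_span_singleton] at h1
  obtain ⟨c, hc⟩ := h1
  refine ⟨c ^ q, herm_injective (q := q) ?_⟩
  rw [← hc]
  ext y
  simp [herm_smul_right, pow_q_pow_q]

lemma mem_span_pair_of_perp {a b x : V5 F}
    (h : ∀ y, herm q a y = 0 → herm q b y = 0 → herm q x y = 0) :
    ∃ s t : F, s • a + t • b = x := by
  have h1 := mem_span_of_iInf_ker_le_ker (ι := Fin 2) (L := ![herm q a, herm q b])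
    (K := herm q x) (by
      intro y hy
      simp only [Submodule.mem_iInf, Fin.forall_fin_two] at hy
      exact h y hy.1 hy.2)
  rw [Matrix.range_cons, Matrix.range_cons, Matrix.range_empty, Set.union_empty,
    Set.singleton_union, Submodule.mem_span_pair] at h1
  obtain ⟨c, d, hc⟩ := h1
  refine ⟨c ^ q, d ^ q, herm_injective (q := q) ?_⟩
  rw [← hc]
  ext y
  simp [herm_smul_right, herm_add_right, pow_q_pow_q]

lemma exists_herm_ne_zero {a : V5 F} (ha : a ≠ 0) : ∃ v, herm q a v ≠ 0 := by
  by_contra h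
  push Not at h
  exact ha ((herm_eq_zero (q := q)).1 (LinearMap.ext h))

lemma finrank_perp {a : V5 F} (ha : a ≠ 0) : finrank F (perp q a) = 4 := by
  obtain ⟨v, hv⟩ := exists_herm_ne_zero (q := q) ha
  have := finrank_inf_ker ⊤ (herm q a) (Submodule.mem_top (x := v)) hv
  rw [finrank_top, Module.finrank_fin_fun, top_inf_eq] at this
  change finrank F (perp q a) + 1 = 5 at this
  omega

lemma exists_mem_perp {a b : V5 F} (hab : LinearIndependent F ![a, b]) :
    ∃ v, herm q a v = 0 ∧ herm q b v ≠ 0 := by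
  by_contra h
  push Not at h
  obtain ⟨s, hs⟩ := mem_span_singleton_of_perp h
  rw [LinearIndependent.pair_iff] at hab
  have := hab s (-1) (by rw [hs]; simp)
  simp at this

lemma finrank_perp_inf {a b : V5 F} (hab : LinearIndependent F ![a, b]) :
    finrank F (perp q a ⊓ perp q b : Submodule F (V5 F)) = 3 := by
  obtain ⟨v, hv, hv'⟩ := exists_mem_perp (q := q) hab
  have := finrank_inf_ker (perp q a) (herm q b) (v := v) hv hv'
  rw [finrank_perp (by have := hab.ne_zero 0; simpa using this)] at this
  change finrank F (perp q a ⊓ perp q b : Submodule F (V5 F)) + 1 = 4 at this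
  omega

lemma rad_perp_le {a x : V5 F} (hx : x ∈ rad q (perp q a)) : ∃ s : F, s • a = x := by
  rw [mem_rad] at hx
  exact mem_span_singleton_of_perp fun y hy => herm_symm.1 (hx.2 y hy)

lemma rad_perp_inf_le {a b x : V5 F} (hx : x ∈ rad q (perp q a ⊓ perp q b)) :
    ∃ s t : F, s • a + t • b = x := by
  rw [mem_rad] at hx
  exact mem_span_pair_of_perp fun y hy hy' => herm_symm.1 (hx.2 y ⟨hy, hy'⟩)

lemma q_mul_cancel {x y : ℤ} (h : (q : ℤ) * x = q * y) : x = y :=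
  mul_left_cancel₀ (by have := q_ge (q := q) (F := F); omega) h

lemma iso_top : iso q (⊤ : Submodule F (V5 F)) = (q : ℤ) ^ 9 - q ^ 5 + q ^ 4 := by
  have h : rad q (⊤ : Submodule F (V5 F)) = ⊥ := by
    rw [eq_bot_iff]
    intro x hx
    rw [mem_rad] at hx
    rw [Submodule.mem_bot, ← herm_eq_zero (q := q)]
    exact LinearMap.ext fun y => herm_symm.1 (hx.2 y Submodule.mem_top)
  have := iso_formula (q := q) (⊤ : Submodule F (V5 F)) 5 0
    (by rw [finrank_top, Module.finrank_fin_fun]) (by rw [h, finrank_bot])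
  apply q_mul_cancel (q := q) (F := F)
  rw [this]; ring

lemma iso_perp_of_iso {a : V5 F} (ha : a ≠ 0) (hI : Iso q a) :
    iso q (perp q a) = (q : ℤ) ^ 7 - q ^ 5 + q ^ 4 := by
  have h : rad q (perp q a) = Submodule.span F {a} := by
    ext x
    rw [Submodule.mem_span_singleton]
    refine ⟨rad_perp_le, ?_⟩
    rintro ⟨s, rfl⟩
    rw [mem_rad]
    refine ⟨Submodule.smul_mem _ _ hI, fun y hy => ?_⟩
    rw [map_smul, herm_symm.1 (mem_perp.1 hy), smul_zero]
  have := iso_formula (q := q) (perp q a) 4 1 (finrank_perp ha)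
    (by rw [h, finrank_span_singleton ha])
  apply q_mul_cancel (q := q) (F := F)
  rw [this]; ring

lemma iso_perp_of_not_iso {a : V5 F} (hI : ¬ Iso q a) :
    iso q (perp q a) = (q : ℤ) ^ 7 + q ^ 4 - q ^ 3 := by
  have h : rad q (perp q a) = ⊥ := by
    rw [eq_bot_iff]
    intro x hx
    obtain ⟨s, rfl⟩ := rad_perp_le hx
    rw [mem_rad, mem_perp, map_smul, smul_eq_mul] at hx
    rw [(mul_eq_zero.1 hx.1).resolve_right hI, zero_smul]
    exact Submodule.zero_mem _
  have ha : a ≠ 0 := by rintro rfl; exact hI (iso_zero q)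
  have := iso_formula (q := q) (perp q a) 4 0 (finrank_perp ha) (by rw [h, finrank_bot])
  apply q_mul_cancel (q := q) (F := F)
  rw [this]; ring

lemma iso_perp_inf_alpha {a A : V5 F} (hA : A ≠ 0) (hI : Iso q A) (ha : ¬ Iso q a)
    (haA : herm q a A = 0) : iso q (perp q A ⊓ perp q a) = (q : ℤ) ^ 5 + q ^ 4 - q ^ 3 := by
  have hind : LinearIndependent F ![A, a] := by
    rw [LinearIndependent.pair_iff' hA]
    rintro s rfl
    exact ha (iso_smul s hI)
  have h : rad q (perp q A ⊓ perp q a) = Submodule.span F {A} := by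
    ext x
    rw [Submodule.mem_span_singleton]
    constructor
    · intro hx
      obtain ⟨s, t, rfl⟩ := rad_perp_inf_le hx
      rw [mem_rad, Submodule.mem_inf] at hx
      have h1 := mem_perp.1 hx.1.2
      rw [map_add, map_smul, map_smul, haA, smul_zero, zero_add, smul_eq_mul] at h1
      rw [(mul_eq_zero.1 h1).resolve_right ha]
      exact ⟨s, by simp⟩
    · rintro ⟨s, rfl⟩
      rw [mem_rad]
      refine ⟨Submodule.smul_mem _ _ ⟨hI, haA⟩, fun y hy => ?_⟩
      rw [map_smul, herm_symm.1 (mem_perp.1 hy.1), smul_zero]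
  have := iso_formula (q := q) (perp q A ⊓ perp q a) 3 1 (finrank_perp_inf hind)
    (by rw [h, finrank_span_singleton hA])
  apply q_mul_cancel (q := q) (F := F)
  rw [this]; ring

lemma iso_perp_inf_beta {z a : V5 F} (hI : Iso q z) (hza : herm q z a ≠ 0) :
    iso q (perp q a ⊓ perp q z) = (q : ℤ) ^ 5 - q ^ 3 + q ^ 2 := by
  have hz : z ≠ 0 := by rintro rfl; exact hza (herm_zero_right a)
  have hind : LinearIndependent F ![a, z] := by
    rw [LinearIndependent.pair_symm_iff, LinearIndependent.pair_iff' hz]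
    rintro s rfl
    rw [map_smul, show herm q z z = 0 from hI, smul_zero] at hza
    exact hza rfl
  have h : rad q (perp q a ⊓ perp q z) = ⊥ := by
    rw [eq_bot_iff]
    intro x hx
    obtain ⟨s, t, rfl⟩ := rad_perp_inf_le hx
    rw [mem_rad, Submodule.mem_inf] at hx
    have h1 := mem_perp.1 hx.1.2
    rw [map_add, map_smul, map_smul, show herm q z z = 0 from hI, smul_zero, add_zero,
      smul_eq_mul] at h1
    have hs := (mul_eq_zero.1 h1).resolve_right hza
    subst hs
    have h2 := mem_perp.1 hx.1.1
    rw [map_add, map_smul, map_smul, zero_smul, zero_add, smul_eq_mul] at h2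
    rw [(mul_eq_zero.1 h2).resolve_right (fun h => hza (herm_symm.1 h))]
    simp
  have := iso_formula (q := q) (perp q a ⊓ perp q z) 3 0 (finrank_perp_inf hind)
    (by rw [h, finrank_bot])
  apply q_mul_cancel (q := q) (F := F)
  rw [this]; ring

lemma iso_perp_inf_gamma {a b : V5 F} (ha : Iso q a) (hb : Iso q b) (hab : herm q a b = 0)
    (hind : LinearIndependent F ![a, b]) : iso q (perp q a ⊓ perp q b) = (q : ℤ) ^ 4 := by
  have h : rad q (perp q a ⊓ perp q b) = Submodule.span F (Set.range ![a, b]) := by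
    ext x
    rw [Matrix.range_cons, Matrix.range_cons, Matrix.range_empty, Set.union_empty,
      Set.singleton_union, Submodule.mem_span_pair]
    refine ⟨rad_perp_inf_le, ?_⟩
    rintro ⟨s, t, rfl⟩
    rw [mem_rad]
    refine ⟨Submodule.add_mem _ (Submodule.smul_mem _ _ ⟨ha, herm_symm.1 hab⟩)
      (Submodule.smul_mem _ _ ⟨hab, hb⟩), fun y hy => ?_⟩
    rw [map_add, map_smul, map_smul, herm_symm.1 (mem_perp.1 hy.1),
      herm_symm.1 (mem_perp.1 hy.2)]
    simp
  have := iso_formula (q := q) (perp q a ⊓ perp q b) 3 2 (finrank_perp_inf hind)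
    (by rw [h, finrank_span_eq_card hind]; simp)
  apply q_mul_cancel (q := q) (F := F)
  rw [this]; ring

/-- Isotropic vectors orthogonal to a totally isotropic line lie on this line. -/
lemma mem_span_of_gamma {a b z : V5 F} (ha : Iso q a) (hb : Iso q b) (hab : herm q a b = 0)
    (hind : LinearIndependent F ![a, b]) (hz : Iso q z) (hza : herm q a z = 0)
    (hzb : herm q b z = 0) : ∃ s t : F, s • a + t • b = z := by
  have h1 := iso_perp_inf_gamma ha hb hab hind
  have h2 : cnt (fun x => x ∈ Submodule.span F (Set.range ![a, b])) = (q : ℤ) ^ 4 := by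
    rw [cnt_mem (q := q), finrank_span_eq_card hind]; simp
  have hmem : ∀ x : V5 F, x ∈ Submodule.span F (Set.range ![a, b]) ↔
      ∃ s t : F, s • a + t • b = x := by
    intro x
    rw [Matrix.range_cons, Matrix.range_cons, Matrix.range_empty, Set.union_empty,
      Set.singleton_union, Submodule.mem_span_pair]
  by_contra hno
  rw [← hmem] at hno
  have h3 : cnt (fun x => x ∈ Submodule.span F (Set.range ![a, b])) <
      iso q (perp q a ⊓ perp q b) := by
    unfold iso cnt
    rw [Nat.cast_lt]
    apply card_lt_card
    rw [ssubset_iff_of_subset]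
    · exact ⟨z, by simpa using ⟨⟨hza, hzb⟩, hz⟩, by simpa using hno⟩
    · intro x hx
      simp only [mem_filter, mem_univ, true_and, hmem] at hx ⊢
      obtain ⟨s, t, rfl⟩ := hx
      refine ⟨⟨?_, ?_⟩, iso_comb ha hb hab s t⟩
      · change herm q a _ = 0
        rw [map_add, map_smul, map_smul, hab, show herm q a a = 0 from ha]; simp
      · change herm q b _ = 0
        rw [map_add, map_smul, map_smul, herm_symm.1 hab,
          show herm q b b = 0 from hb]; simp
  omega

lemma iso_perp_inf_le {A b : V5 F} (hA : Iso q A) (hAb : herm q b A = 0)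
    (hind : LinearIndependent F ![A, b]) :
    iso q (perp q A ⊓ perp q b) ≤ (q : ℤ) ^ 5 + q ^ 4 - q ^ 3 := by
  have hA0 : A ≠ 0 := by have := hind.ne_zero 0; simpa using this
  by_cases hb : Iso q b
  · rw [iso_perp_inf_gamma hA hb (herm_symm.1 hAb) hind]
    have h7 := q_ge (q := q) (F := F)
    nlinarith [pow_pos (show (0 : ℤ) < q by omega) 3, pow_pos (show (0 : ℤ) < q by omega) 4]
  · rw [iso_perp_inf_alpha hA0 hA hb hAb]

lemma le_iso_perp_inf {a b : V5 F} (hind : LinearIndependent F ![a, b]) :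
    (q : ℤ) ^ 2 ≤ iso q (perp q a ⊓ perp q b) := by
  have hle : rad q (perp q a ⊓ perp q b) ≤ Submodule.span F (Set.range ![a, b]) := by
    intro x hx
    rw [Matrix.range_cons, Matrix.range_cons, Matrix.range_empty, Set.union_empty,
      Set.singleton_union, Submodule.mem_span_pair]
    exact rad_perp_inf_le hx
  have hr := Submodule.finrank_mono hle
  rw [finrank_span_eq_card hind, Fintype.card_fin] at hr
  have := iso_formula (q := q) (perp q a ⊓ perp q b) 3 _ (finrank_perp_inf hind) rfl
  set r := finrank F (rad q (perp q a ⊓ perp q b))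
  have h7 := q_ge (q := q) (F := F)
  have h0 : (0 : ℤ) < q := by omega
  refine le_of_mul_le_mul_left ?_ h0
  rw [this]
  have h2 : (0 : ℤ) < q ^ 2 := by positivity
  have h3 : (0 : ℤ) < q ^ 3 := by positivity
  have h4 : (0 : ℤ) < q ^ 4 := by positivity
  have h5 : (0 : ℤ) < q ^ 5 := by positivity
  interval_cases r <;> norm_num <;> nlinarith

end IsoFormula

section Forms

variable {F : Type} [Field F]

/-- A homogeneous function of degree `d` which is polynomial along lines, together with its
differential. -/
structure Form (d : ℕ) (F : Type) [Field F] where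
  /-- the function -/
  f : V5 F → F
  /-- its differential -/
  D : V5 F → V5 F →ₗ[F] F
  smul : ∀ c x, f (c • x) = c ^ d * f x
  euler : ∀ x, D x x = d * f x
  line : ∀ x y, ∃ p : Polynomial F, p.natDegree ≤ d ∧ (∀ t, p.eval t = f (x + t • y)) ∧
    (∀ t, p.derivative.eval t = D (x + t • y) y) ∧ p.coeff d = f y ∧ p.coeff (d - 1) = D y x

/-- The quadratic form attached to a bilinear form. -/
def quadForm (B : V5 F →ₗ[F] V5 F →ₗ[F] F) : Form 2 F where
  f x := B x x
  D x := B x + B.flip x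
  smul c x := by simp; ring
  euler x := by simp; ring
  line x y := by
    refine ⟨.C (B x x) + .C (B x y + B y x) * .X + .C (B y y) * .X ^ 2, by compute_degree,
      fun t => ?_, fun t => ?_, ?_, ?_⟩
    · simp; ring
    · simp; ring
    · simp only [Polynomial.coeff_add, Polynomial.coeff_C_mul, Polynomial.coeff_X_pow,
        Polynomial.coeff_X, Polynomial.coeff_C]
      norm_num
    · simp only [Polynomial.coeff_add, Polynomial.coeff_C_mul, Polynomial.coeff_X_pow,
        Polynomial.coeff_X, Polynomial.coeff_C]
      norm_num; ring

/-- The cubic form attached to a trilinear form. -/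
def cubicForm (T : V5 F →ₗ[F] V5 F →ₗ[F] V5 F →ₗ[F] F) : Form 3 F where
  f x := T x x x
  D x := T x x + (T x).flip x + (T.flip x).flip x
  smul c x := by simp; ring
  euler x := by simp; ring
  line x y := by
    refine ⟨.C (T x x x) + .C (T x x y + T x y x + T y x x) * .X +
      .C (T x y y + T y x y + T y y x) * .X ^ 2 + .C (T y y y) * .X ^ 3, by compute_degree,
      fun t => ?_, fun t => ?_, ?_, ?_⟩
    · simp; ring
    · simp; ring
    · simp only [Polynomial.coeff_add, Polynomial.coeff_C_mul, Polynomial.coeff_X_pow,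
        Polynomial.coeff_X, Polynomial.coeff_C]
      norm_num
    · simp only [Polynomial.coeff_add, Polynomial.coeff_C_mul, Polynomial.coeff_X_pow,
        Polynomial.coeff_X, Polynomial.coeff_C]
      norm_num; ring

variable {d : ℕ} (Φ : Form d F)

/-- Every direction orthogonal to `x` is tangent to the zero locus at `x`. -/
def Form.Sing (q : ℕ) (x : V5 F) : Prop := ∀ y, herm q x y = 0 → Φ.D x y = 0

/-- The weight of a vector. -/
def Form.wt (q : ℕ) (x : V5 F) : ℤ := if Φ.f x = 0 then (if Φ.Sing q x then 2 else 1) else 0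

/-- The form vanishes on the span of `x` and `y`. -/
def Form.Bad (x y : V5 F) : Prop := ∀ s t : F, Φ.f (s • x + t • y) = 0

lemma Form.bad_iff {x y : V5 F} : Φ.Bad x y ↔ Φ.f y = 0 ∧ ∀ t : F, Φ.f (x + t • y) = 0 := by
  constructor
  · intro h
    exact ⟨by simpa using h 0 1, fun t => by simpa using h 1 t⟩
  · rintro ⟨h1, h2⟩ s t
    by_cases hs : s = 0
    · subst hs
      rw [zero_smul, zero_add, Φ.smul, h1, mul_zero]
    · have : s • x + t • y = s • (x + (s⁻¹ * t) • y) := by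
        rw [smul_add, smul_smul, mul_inv_cancel_left₀ hs]
      rw [this, Φ.smul, h2, mul_zero]

lemma Form.bad_swap {x y : V5 F} (h : Φ.Bad x y) : Φ.Bad y x := fun s t => by
  rw [add_comm]; exact h t s

lemma Form.bad_add {x y : V5 F} (t : F) (h : Φ.Bad x y) : Φ.Bad (x + t • y) y := fun s t' => by
  have := h s (s * t + t')
  rwa [add_smul, mul_smul, ← add_assoc, ← smul_add] at this

lemma cnt_root_le [Fintype F] {p : Polynomial F} (hp : p ≠ 0) (hd : p.natDegree ≤ d) :
    cnt (fun t : F => p.eval t = 0) ≤ d := by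
  unfold cnt
  have : univ.filter (fun t : F => p.eval t = 0) ⊆ p.roots.toFinset := by
    intro t ht
    simpa [hp] using ht
  exact_mod_cast (card_le_card this).trans
    ((Multiset.toFinset_card_le _).trans ((Polynomial.card_roots' p).trans hd))

lemma Form.cnt_line_le [Fintype F] (x : V5 F) {v : V5 F} (hv : Φ.f v ≠ 0) :
    cnt (fun t : F => Φ.f (x + t • v) = 0) ≤ d := by
  obtain ⟨p, hd, hp, -, hc, -⟩ := Φ.line x v
  simp only [← hp]
  refine cnt_root_le (fun h => hv ?_) hd
  rw [← hc, h, Polynomial.coeff_zero]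

variable {q : ℕ} [Fintype F] [hq : HermField q F]

include hq

/-- Averaging over translations. -/
lemma translate (Ω P : V5 F → Prop) (v : V5 F) (hΩ : ∀ x (t : F), Ω x → Ω (x + t • v)) :
    (q : ℤ) ^ 2 * cnt (fun x => Ω x ∧ P x) =
      ∑ x, if Ω x then cnt (fun t : F => P (x + t • v)) else 0 := by
  have h1 : ∀ t : F, cnt (fun x => Ω x ∧ P x) = cnt (fun x => Ω x ∧ P (x + t • v)) := by
    intro t
    refine cnt_bij (fun x => x + (-t) • v) (fun x => x + t • v) ?_ ?_ ?_ ?_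
    · rintro x ⟨hx, hP⟩
      exact ⟨hΩ x _ hx, by simpa using hP⟩
    · rintro x ⟨hx, hP⟩
      exact ⟨hΩ x _ hx, hP⟩
    · intro x _; simp
    · intro x _; simp
  have h2 : ∑ t : F, cnt (fun x => Ω x ∧ P (x + t • v)) =
      (q : ℤ) ^ 2 * cnt (fun x => Ω x ∧ P x) := by
    rw [← sum_congr rfl fun t _ => h1 t, sum_const, card_univ, hq.card, nsmul_eq_mul]
    push_cast; rfl
  rw [← h2, sum_cnt_comm (fun (t : F) x => Ω x ∧ P (x + t • v))]
  refine sum_congr rfl fun x _ => ?_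
  split_ifs with h
  · simp only [h, true_and]
  · simp [h, cnt]

lemma translate_le (Ω P : V5 F → Prop) (v : V5 F) (hΩ : ∀ x (t : F), Ω x → Ω (x + t • v)) (k : ℤ)
    (hk : ∀ x, Ω x → cnt (fun t : F => P (x + t • v)) ≤ k) :
    (q : ℤ) ^ 2 * cnt (fun x => Ω x ∧ P x) ≤ cnt Ω * k := by
  rw [translate (q := q) Ω P v hΩ, ← sum_ite_const_eq]
  refine sum_le_sum fun x _ => ?_
  split_ifs with h
  · exact hk x h
  · exact le_rfl

/-- A form of degree `d` has at most `d |W| / q ^ 2` zeros on a subspace `W` where it is not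
identically zero. -/
lemma Form.schwartz_zippel (W : Submodule F (V5 F)) {v : V5 F} (hvW : v ∈ W) (hv : Φ.f v ≠ 0) :
    (q : ℤ) ^ 2 * cnt (fun x => x ∈ W ∧ Φ.f x = 0) ≤ q ^ (2 * finrank F W) * d := by
  rw [← cnt_mem (q := q) W]
  exact translate_le (q := q) _ _ v (fun x t hx => W.add_mem hx (W.smul_mem t hvW)) d
    fun x _ => Φ.cnt_line_le x hv

/-- Pairs spanning a totally isotropic line on which the form is not identically zero. -/
def Form.Pair (q : ℕ) (Φ : Form d F) (U : Submodule F (V5 F)) (x y : V5 F) : Prop :=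
  x ∈ U ∧ y ∈ U ∧ Iso q x ∧ Iso q y ∧ herm q x y = 0 ∧ LinearIndependent F ![x, y] ∧ ¬ Φ.Bad x y

lemma Form.pair_swap {U : Submodule F (V5 F)} {x y : V5 F} (h : Φ.Pair q U x y) :
    Φ.Pair q U y x := by
  obtain ⟨h1, h2, h3, h4, h5, h6, h7⟩ := h
  exact ⟨h2, h1, h4, h3, herm_symm.1 h5, LinearIndependent.pair_symm_iff.1 h6,
    fun h => h7 (Φ.bad_swap h)⟩

lemma Form.pair_add {U : Submodule F (V5 F)} {x y : V5 F} (t : F) (h : Φ.Pair q U x y) :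
    Φ.Pair q U (x + t • y) y := by
  obtain ⟨h1, h2, h3, h4, h5, h6, h7⟩ := h
  refine ⟨U.add_mem h1 (U.smul_mem t h2), h2, ?_, h4, ?_, ?_, fun h => h7 ?_⟩
  · exact iso_add h3 (iso_smul t h4) (by rw [map_smul, h5, smul_zero])
  · rw [herm_add_right, h5, herm_smul_right, show herm q y y = 0 from h4]; simp
  · rw [LinearIndependent.pair_iff] at h6 ⊢
    intro a b hab
    have := h6 a (a * t + b) (by rw [add_smul, mul_smul, ← add_assoc, ← smul_add]; exact hab)
    refine ⟨this.1, ?_⟩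
    rw [this.1, zero_mul, zero_add] at this
    exact this.2
  · have := Φ.bad_add (-t) h
    simpa using this

lemma Form.sum_wt_le (hd : 2 ≤ d) {U : Submodule F (V5 F)} {x y : V5 F} (h : Φ.Pair q U x y) :
    ∑ t : F, Φ.wt q (x + t • y) + Φ.wt q y ≤ d := by
  obtain ⟨p, hdeg, hp, hp', hc, hc'⟩ := Φ.line x y
  have hp0 : p ≠ 0 := by
    rintro rfl
    refine h.2.2.2.2.2.2 (Φ.bad_iff.2 ⟨?_, fun t => ?_⟩)
    · rw [← hc, Polynomial.coeff_zero]
    · rw [← hp, Polynomial.eval_zero]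
  have h1 : ∀ t : F, Φ.wt q (x + t • y) ≤ (p.rootMultiplicity t : ℤ) := by
    intro t
    unfold Form.wt
    split_ifs with hf hs
    · have h2 : herm q (x + t • y) y = 0 := (Φ.pair_add t h).2.2.2.2.1
      have h3 := (Polynomial.one_lt_rootMultiplicity_iff_isRoot hp0 (t := t)).2
        ⟨by rw [Polynomial.IsRoot, hp, hf], by rw [Polynomial.IsRoot, hp', hs y h2]⟩
      exact_mod_cast h3
    · have := (Polynomial.rootMultiplicity_pos hp0 (x := t)).2 (by rw [Polynomial.IsRoot, hp, hf])
      exact_mod_cast this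
    · positivity
  have h2 : ∑ t : F, (p.rootMultiplicity t : ℤ) ≤ p.natDegree := by
    have := Multiset.sum_count_eq_card (s := univ) (m := p.roots) (fun a _ => mem_univ a)
    simp only [Polynomial.count_roots] at this
    have h3 := p.card_roots'
    rw [← this] at h3
    exact_mod_cast h3
  have h3 : (p.natDegree : ℤ) + Φ.wt q y ≤ d := by
    unfold Form.wt
    have hlt : Φ.f y = 0 → p.natDegree < d := by
      intro hf
      refine lt_of_le_of_ne hdeg fun he => hp0 ?_
      rw [← Polynomial.leadingCoeff_eq_zero, Polynomial.leadingCoeff, he, hc, hf]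
    split_ifs with hf hs
    · have h4 := hlt hf
      have h5 : p.natDegree ≠ d - 1 := by
        intro he
        apply hp0
        rw [← Polynomial.leadingCoeff_eq_zero, Polynomial.leadingCoeff, he, hc',
          hs x (herm_symm.1 h.2.2.2.2.1)]
      have : p.natDegree + 2 ≤ d := by omega
      exact_mod_cast this
    · exact_mod_cast hlt hf
    · simpa using hdeg
  have h4 := sum_le_sum fun t (_ : t ∈ (univ : Finset F)) => h1 t
  linarith

lemma Form.pair_sum (hd : 2 ≤ d) (U : Submodule F (V5 F)) :
    ((q : ℤ) ^ 2 + 1) * ∑ p : V5 F × V5 F, (if Φ.Pair q U p.1 p.2 then Φ.wt q p.1 else 0) ≤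
      d * cnt (fun p : V5 F × V5 F => Φ.Pair q U p.1 p.2) := by
  set S := ∑ p : V5 F × V5 F, (if Φ.Pair q U p.1 p.2 then Φ.wt q p.1 else 0) with hS
  have h1 : S = ∑ p : V5 F × V5 F, (if Φ.Pair q U p.1 p.2 then Φ.wt q p.2 else 0) := by
    rw [hS, ← Equiv.sum_comp (Equiv.prodComm (V5 F) (V5 F))]
    refine sum_congr rfl fun p _ => ?_
    have : Φ.Pair q U p.2 p.1 ↔ Φ.Pair q U p.1 p.2 := ⟨Φ.pair_swap, Φ.pair_swap⟩
    simp [this]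
  have h2 : ∀ t : F, S =
      ∑ p : V5 F × V5 F, (if Φ.Pair q U p.1 p.2 then Φ.wt q (p.1 + t • p.2) else 0) := by
    intro t
    let e : V5 F × V5 F ≃ V5 F × V5 F :=
      { toFun := fun p => (p.1 + t • p.2, p.2)
        invFun := fun p => (p.1 + (-t) • p.2, p.2)
        left_inv := fun p => by simp
        right_inv := fun p => by simp }
    rw [hS, ← Equiv.sum_comp e]
    refine sum_congr rfl fun p _ => ?_
    have : Φ.Pair q U (e p).1 (e p).2 ↔ Φ.Pair q U p.1 p.2 := by
      refine ⟨fun h => ?_, Φ.pair_add t⟩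
      have := Φ.pair_add (-t) h
      simpa [e] using this
    simp only [this]; rfl
  have h3 : (q : ℤ) ^ 2 * S = ∑ p : V5 F × V5 F,
      (if Φ.Pair q U p.1 p.2 then ∑ t : F, Φ.wt q (p.1 + t • p.2) else 0) := by
    have : ∑ t : F, S = (q : ℤ) ^ 2 * S := by
      rw [sum_const, card_univ, hq.card, nsmul_eq_mul]; push_cast; rfl
    rw [← this, sum_congr rfl fun t _ => h2 t, sum_comm]
    refine sum_congr rfl fun p _ => ?_
    split_ifs <;> simp
  have h4 : ((q : ℤ) ^ 2 + 1) * S = ∑ p : V5 F × V5 F,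
      (if Φ.Pair q U p.1 p.2 then ∑ t : F, Φ.wt q (p.1 + t • p.2) + Φ.wt q p.2 else 0) := by
    rw [add_mul, one_mul, h3]
    rw [h1, ← sum_add_distrib]
    refine sum_congr rfl fun p _ => ?_
    split_ifs <;> simp
  rw [h4, mul_comm, ← sum_ite_const_eq]
  refine sum_le_sum fun p _ => ?_
  split_ifs with h
  · exact Φ.sum_wt_le hd h
  · exact le_rfl

/-- The number of isotropic `y ∈ U` orthogonal to `x` such that the form vanishes on the span of
`x` and `y`. -/
def Form.bad (q : ℕ) (Φ : Form d F) (U : Submodule F (V5 F)) (x : V5 F) : ℤ :=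
  cnt fun y => y ∈ U ⊓ perp q x ∧ Iso q y ∧ Φ.Bad x y

/-- The weighted incidence inequality. -/
lemma Form.weighted_le (hd : 2 ≤ d) (U : Submodule F (V5 F)) (μ : ℤ)
    (hμ : ∀ x ∈ U, x ≠ 0 → Iso q x → iso q (U ⊓ perp q x) = μ) :
    ((q : ℤ) ^ 2 + 1) * ∑ x : V5 F, (if x ∈ U ∧ x ≠ 0 ∧ Iso q x then
      Φ.wt q x * (μ - Φ.bad q U x) else 0) ≤
      d * (cnt (fun x : V5 F => x ∈ U ∧ x ≠ 0 ∧ Iso q x) * (μ - q ^ 2)) := by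
  refine le_trans (le_of_eq ?_) ((Φ.pair_sum (q := q) hd U).trans ?_)
  · congr 1
    rw [Fintype.sum_prod_type]
    refine sum_congr rfl fun x _ => ?_
    have h0 : (∑ y, if Φ.Pair q U (x, y).1 (x, y).2 then Φ.wt q (x, y).1 else 0) =
      cnt (fun y => Φ.Pair q U x y) * Φ.wt q x := by rw [← sum_ite_const_eq]
    rw [h0]
    split_ifs with h
    · obtain ⟨hxU, hx0, hI⟩ := h
      by_cases hf : Φ.f x = 0
      · have h1 := cnt_split (fun y => y ∈ U ⊓ perp q x ∧ Iso q y) (fun y => Φ.Bad x y)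
        have h2 := hμ x hxU hx0 hI
        have h3 : cnt (fun y => (y ∈ U ⊓ perp q x ∧ Iso q y) ∧ Φ.Bad x y) = Φ.bad q U x :=
          cnt_congr fun y => and_assoc
        have h4 : cnt (fun y => (y ∈ U ⊓ perp q x ∧ Iso q y) ∧ ¬ Φ.Bad x y) =
            cnt (fun y => Φ.Pair q U x y) := by
          refine cnt_congr fun y => ⟨?_, ?_⟩
          · rintro ⟨⟨⟨hy, hy'⟩, hyI⟩, hb⟩
            refine ⟨hxU, hy, hI, hyI, hy', ?_, hb⟩
            rw [LinearIndependent.pair_iff' hx0]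
            rintro c rfl
            refine hb fun s t => ?_
            rw [smul_smul, ← add_smul, Φ.smul, hf, mul_zero]
          · rintro ⟨_, hy, _, hyI, hy', _, hb⟩
            exact ⟨⟨⟨hy, hy'⟩, hyI⟩, hb⟩
        unfold iso at h2
        rw [h2, h3, h4] at h1
        rw [h1]; ring
      · have : Φ.wt q x = 0 := by unfold Form.wt; rw [if_neg hf]
        simp [this]
    · have : ∀ y, ¬ Φ.Pair q U x y := by
        rintro y ⟨h1, _, h2, _, _, h3, _⟩
        exact h ⟨h1, by simpa using h3.ne_zero 0, h2⟩
      simp [cnt, this]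
  · refine mul_le_mul_of_nonneg_left ?_ (by positivity)
    rw [cnt_pair (fun x y => Φ.Pair q U x y), ← sum_ite_const_eq]
    refine sum_le_sum fun x _ => ?_
    split_ifs with h
    · obtain ⟨hxU, hx0, hI⟩ := h
      rw [← hμ x hxU hx0 hI]
      have h1 := cnt_split (fun y => y ∈ U ⊓ perp q x ∧ Iso q y)
        (fun y => y ∈ Submodule.span F {x})
      have h2 : cnt (fun y => (y ∈ U ⊓ perp q x ∧ Iso q y) ∧ y ∈ Submodule.span F {x}) =
          (q : ℤ) ^ 2 := by
        have := cnt_mem (q := q) (Submodule.span F {x})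
        rw [finrank_span_singleton hx0, mul_one] at this
        rw [← this]
        refine cnt_congr fun y => ⟨fun h => h.2, fun h => ⟨?_, h⟩⟩
        obtain ⟨c, rfl⟩ := Submodule.mem_span_singleton.1 h
        exact ⟨⟨U.smul_mem c hxU, Submodule.smul_mem _ _ hI⟩, iso_smul c hI⟩
      have h3 : cnt (fun y => Φ.Pair q U x y) ≤
          cnt (fun y => (y ∈ U ⊓ perp q x ∧ Iso q y) ∧ ¬ y ∈ Submodule.span F {x}) := by
        refine cnt_mono fun y => ?_
        rintro ⟨_, hy, _, hyI, hy', hl, _⟩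
        refine ⟨⟨⟨hy, hy'⟩, hyI⟩, fun hs => ?_⟩
        obtain ⟨c, rfl⟩ := Submodule.mem_span_singleton.1 hs
        exact (LinearIndependent.pair_iff' hx0).1 hl c rfl
      unfold iso
      linarith
    · have : ∀ y, ¬ Φ.Pair q U x y := by
        rintro y ⟨h1, _, h2, _, _, h3, _⟩
        exact h ⟨h1, by simpa using h3.ne_zero 0, h2⟩
      simp [cnt, this]

end Forms

section Factor

variable {F : Type} [Field F]

/-- The projection to the kernel of `l` along `v`, where `l v = 1`. -/
def proj (l : V5 F →ₗ[F] F) (v : V5 F) : V5 F →ₗ[F] V5 F := LinearMap.id - l.smulRight v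

lemma proj_apply (l : V5 F →ₗ[F] F) (v x : V5 F) : proj l v x = x - l x • v := by simp [proj]

lemma eq_proj_add (l : V5 F →ₗ[F] F) (v x : V5 F) : x = proj l v x + l x • v := by
  simp [proj_apply]

/-- A quadratic form on a subspace vanishing on a hyperplane is a product. -/
lemma quad_factor (B : V5 F →ₗ[F] V5 F →ₗ[F] F) (W : Submodule F (V5 F)) (l : V5 F →ₗ[F] F)
    {v : V5 F} (hvW : v ∈ W) (hv : l v = 1) (h : ∀ x ∈ W, l x = 0 → B x x = 0) :
    ∃ m : V5 F →ₗ[F] F, ∀ x ∈ W, B x x = l x * m x := by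
  refine ⟨B v ∘ₗ proj l v + B.flip v ∘ₗ proj l v + B v v • l, fun x hx => ?_⟩
  have h0 : B (proj l v x) (proj l v x) = 0 := by
    apply h
    · rw [proj_apply]; exact W.sub_mem hx (W.smul_mem _ hvW)
    · rw [proj_apply, map_sub, map_smul, hv]; simp
  have h1 : B x x = B (proj l v x + l x • v) (proj l v x + l x • v) := by rw [← eq_proj_add]
  rw [h1]
  simp only [map_add, map_smul, LinearMap.add_apply, LinearMap.smul_apply, h0,
    LinearMap.comp_apply, LinearMap.flip_apply, smul_eq_mul]
  ring

/-- A cubic form vanishing on a hyperplane is the product of a linear and a quadratic form. -/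
lemma cubic_factor (T : V5 F →ₗ[F] V5 F →ₗ[F] V5 F →ₗ[F] F) (l : V5 F →ₗ[F] F)
    {v : V5 F} (hv : l v = 1) (h : ∀ x, l x = 0 → T x x x = 0) :
    ∃ B : V5 F →ₗ[F] V5 F →ₗ[F] F, ∀ x, T x x x = l x * B x x := by
  refine ⟨(T v + T.flip v + T.compr₂ (LinearMap.applyₗ v)).compl₁₂ (proj l v) (proj l v) +
    (LinearMap.mul F F).compl₁₂ l ((T v v + (T v).flip v + (T.flip v).flip v) ∘ₗ proj l v +
      T v v v • l), fun x => ?_⟩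
  have h0 : T (proj l v x) (proj l v x) (proj l v x) = 0 := by
    apply h
    rw [proj_apply, map_sub, map_smul, hv]; simp
  have h1 : T x x x = T (proj l v x + l x • v) (proj l v x + l x • v) (proj l v x + l x • v) := by
    rw [← eq_proj_add]
  rw [h1]
  simp only [LinearMap.compl₁₂_apply, LinearMap.compr₂_apply, LinearMap.mul_apply',
    LinearMap.applyₗ_apply_apply, LinearMap.comp_apply, LinearMap.flip_apply,
    map_add, map_smul, LinearMap.add_apply, LinearMap.smul_apply, h0, smul_eq_mul]
  ring

end Factor

section Regular

variable {F : Type} [Field F] {d : ℕ} (Φ : Form d F) {q : ℕ}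

/-- `A` is a regular zero with tangent hyperplane orthogonal to `b`. -/
def Form.Reg (q : ℕ) (Φ : Form d F) (A b : V5 F) : Prop :=
  Iso q A ∧ Φ.f A = 0 ∧ Φ.D A = herm q b ∧ herm q b A = 0 ∧ LinearIndependent F ![A, b]

variable {Φ} in
lemma Form.Reg.ne_zero {A b : V5 F} (h : Φ.Reg q A b) : A ≠ 0 := by
  simpa using h.2.2.2.2.ne_zero 0

variable [Fintype F] [hq : HermField q F]

include hq

lemma Form.D_eq_zero_of_bad (hd : d ≤ 3) {A z : V5 F} (h : Φ.Bad A z) : Φ.D A z = 0 := by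
  obtain ⟨p, hdeg, hp, hp', -, -⟩ := Φ.line A z
  have hp0 : p = 0 := by
    by_contra hne
    have h1 := cnt_root_le hne hdeg
    have h2 : ∀ t : F, p.eval t = 0 := fun t => by rw [hp]; exact (Φ.bad_iff.1 h).2 t
    have h3 : cnt (fun t : F => p.eval t = 0) = (q : ℤ) ^ 2 := by simp [cnt, h2, hq.card]
    have h4 := q_ge (q := q) (F := F)
    have h5 : (d : ℤ) ≤ 3 := by exact_mod_cast hd
    nlinarith
  have := hp' 0
  rw [hp0, zero_smul, add_zero] at this
  simpa using this.symm

lemma Form.exists_reg {A : V5 F} (hA : A ≠ 0) (hI : Iso q A) (hf : Φ.f A = 0)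
    (hS : ¬ Φ.Sing q A) : ∃ b, Φ.Reg q A b := by
  obtain ⟨b, hb⟩ := exists_herm_eq (q := q) (Φ.D A)
  refine ⟨b, hI, hf, hb, ?_, ?_⟩
  · rw [← hb, Φ.euler, hf, mul_zero]
  · rw [LinearIndependent.pair_iff' hA]
    rintro c rfl
    refine hS fun y hy => ?_
    rw [hb, herm_smul_right, hy, mul_zero]

lemma Form.bad_le_of_reg (hd : d ≤ 3) {A b : V5 F} (h : Φ.Reg q A b) :
    Φ.bad q ⊤ A ≤ iso q (perp q A ⊓ perp q b) := by
  refine cnt_mono fun z => ?_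
  rintro ⟨⟨-, hz⟩, hI, hB⟩
  refine ⟨⟨hz, ?_⟩, hI⟩
  change herm q b z = 0
  rw [← h.2.2.1]
  exact Φ.D_eq_zero_of_bad (q := q) hd hB

lemma Form.bad_le_of_reg_of_ne (hd : d ≤ 3) {A b v : V5 F} (h : Φ.Reg q A b)
    (hv : v ∈ perp q A ⊓ perp q b) (hf : Φ.f v ≠ 0) :
    Φ.bad q ⊤ A ≤ (q : ℤ) ^ 2 + d * (q ^ 4 - q ^ 2) := by
  have hA0 := h.ne_zero
  have hAv : LinearIndependent F ![A, v] := by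
    rw [LinearIndependent.pair_iff' hA0]
    rintro c rfl
    rw [Φ.smul, h.2.1, mul_zero] at hf
    exact hf rfl
  have hAmem : A ∈ perp q A ⊓ perp q b := ⟨h.1, h.2.2.2.1⟩
  set W := perp q A ⊓ perp q b with hW
  set L := Submodule.span F (Set.range ![A, v]) with hL
  have hmemL : ∀ x, x ∈ L ↔ ∃ s t : F, s • A + t • v = x := by
    intro x
    rw [hL, Matrix.range_cons, Matrix.range_cons, Matrix.range_empty, Set.union_empty,
      Set.singleton_union, Submodule.mem_span_pair]
  have hLW : L ≤ W := by
    intro x hx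
    obtain ⟨s, t, rfl⟩ := (hmemL x).1 hx
    exact W.add_mem (W.smul_mem s hAmem) (W.smul_mem t hv)
  have hvL : v ∈ L := (hmemL v).2 ⟨0, 1, by simp⟩
  have h1 : (q : ℤ) ^ 2 * cnt (fun x => (x ∈ W ∧ x ∉ L) ∧ Φ.Bad A x) ≤
      cnt (fun x => x ∈ W ∧ x ∉ L) * d := by
    refine translate_le _ _ v ?_ d ?_
    · rintro x t ⟨hx, hx'⟩
      refine ⟨W.add_mem hx (W.smul_mem t hv), fun hL' => hx' ?_⟩
      have := L.sub_mem hL' (L.smul_mem t hvL)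
      rwa [add_sub_cancel_right] at this
    · intro x _
      refine (cnt_mono fun t ht => ?_).trans (Φ.cnt_line_le x hf)
      exact (Φ.bad_iff.1 ht).1
  have h2 := cnt_split (fun x => x ∈ W) (fun x => x ∈ L)
  have h3 : cnt (fun x => x ∈ W) = (q : ℤ) ^ 6 := by
    rw [cnt_mem (q := q), hW, finrank_perp_inf h.2.2.2.2]
  have h4 : cnt (fun x => x ∈ W ∧ x ∈ L) = (q : ℤ) ^ 4 := by
    have : cnt (fun x => x ∈ L) = (q : ℤ) ^ 4 := by
      rw [cnt_mem (q := q), hL, finrank_span_eq_card hAv, Fintype.card_fin]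
    rw [← this]
    exact cnt_congr fun x => ⟨fun h => h.2, fun h => ⟨hLW h, h⟩⟩
  rw [h3, h4] at h2
  have h5 : Φ.bad q ⊤ A ≤ cnt (fun x => (x ∈ W ∧ x ∉ L) ∧ Φ.Bad A x) +
      cnt (fun x => x ∈ Submodule.span F {A}) := by
    refine le_trans (cnt_mono fun z => ?_) (cnt_or_le _ _)
    rintro ⟨⟨-, hz⟩, hI, hB⟩
    have hzW : z ∈ W := ⟨hz, by
      change herm q b z = 0
      rw [← h.2.2.1]; exact Φ.D_eq_zero_of_bad (q := q) hd hB⟩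
    by_cases hzL : z ∈ L
    · right
      obtain ⟨s, t, rfl⟩ := (hmemL z).1 hzL
      by_cases ht : t = 0
      · subst ht
        rw [zero_smul, add_zero]
        exact Submodule.smul_mem _ _ (Submodule.mem_span_singleton_self A)
      · refine absurd ?_ hf
        have := hB (-t⁻¹ * s) t⁻¹
        rw [smul_add, smul_smul, smul_smul, inv_mul_cancel₀ ht, one_smul, ← add_assoc,
          ← add_smul, neg_mul, neg_add_cancel, zero_smul, zero_add] at this
        exact this
    · exact Or.inl ⟨⟨hzW, hzL⟩, hB⟩
  rw [cnt_mem (q := q) (Submodule.span F {A}), finrank_span_singleton hA0, mul_one] at h5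
  have h7 := q_ge (q := q) (F := F)
  have h8 : cnt (fun x => x ∈ W ∧ x ∉ L) = (q : ℤ) ^ 6 - q ^ 4 := by linarith
  rw [h8] at h1
  have h9 : (q : ℤ) ^ 2 * cnt (fun x => (x ∈ W ∧ x ∉ L) ∧ Φ.Bad A x) ≤
      (q : ℤ) ^ 2 * (d * (q ^ 4 - q ^ 2)) := by
    calc _ ≤ _ := h1
      _ = _ := by ring
  have h10 := le_of_mul_le_mul_left h9 (by positivity)
  linarith

end Regular

section Conic

variable {F : Type} [Field F]

lemma exists_comb_of_finrank_three {W : Submodule F (V5 F)} (hW : finrank F W = 3) {A P e : V5 F}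
    (hAP : LinearIndependent F ![A, P]) (he : ¬ ∃ s t : F, s • A + t • P = e) (hA : A ∈ W)
    (hP : P ∈ W) (heW : e ∈ W) {x : V5 F} (hx : x ∈ W) :
    ∃ r s t : F, x = r • e + (s • A + t • P) := by
  have hl : LinearIndependent F ![e, A, P] := by
    refine linearIndependent_finCons.2 ⟨hAP, fun h => he ?_⟩
    rwa [Matrix.range_cons, Matrix.range_cons, Matrix.range_empty, Set.union_empty,
      Set.singleton_union, Submodule.mem_span_pair] at h
  have hle : Submodule.span F (Set.range ![e, A, P]) ≤ W := by
    rw [Submodule.span_le]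
    rintro _ ⟨i, rfl⟩
    fin_cases i
    · exact heW
    · exact hA
    · exact hP
  have heq := Submodule.eq_of_le_of_finrank_eq hle (by
    rw [finrank_span_eq_card hl, hW, Fintype.card_fin])
  rw [← heq, Matrix.range_cons, Matrix.range_cons, Matrix.range_cons, Matrix.range_empty,
    Set.union_empty, Set.singleton_union, Set.singleton_union, Submodule.mem_span_insert] at hx
  obtain ⟨r, z, hz, rfl⟩ := hx
  obtain ⟨s, t, rfl⟩ := Submodule.mem_span_pair.1 hz
  exact ⟨r, s, t, rfl⟩

variable {q : ℕ} [Fintype F] [hq : HermField q F]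

include hq

lemma cnt_univ_field : cnt (fun _ : F => True) = (q : ℤ) ^ 2 := by simp [cnt, hq.card]

lemma cnt_ne_zero_field : cnt (fun t : F => t ≠ 0) = (q : ℤ) ^ 2 - 1 := by
  have h1 := cnt_split (fun _ : F => True) (fun t => t = 0)
  have h2 : cnt (fun t : F => t = 0) = 1 := by rw [cnt_eq_sum]; simp
  simp only [true_and] at h1
  rw [cnt_univ_field (q := q), h2] at h1
  simp only [ne_eq]
  linarith

/-- A cone over a pair of planes. -/
lemma conic_of_plane (B : V5 F →ₗ[F] V5 F →ₗ[F] F) {A c v : V5 F} (hA : Iso q A)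
    (hS : ∀ y, herm q A y = 0 → B A y + B y A = 0)
    (hv : herm q A v = 0) (hBv : B v v ≠ 0) (hcA : herm q c A = 0)
    (hAc : LinearIndependent F ![A, c])
    (hc : ∀ x, herm q A x = 0 → herm q c x = 0 → B x x = 0) :
    cnt (fun z => herm q A z = 0 ∧ Iso q z ∧ B z z = 0) ≤
      (q : ℤ) ^ 2 + 2 * (q ^ 5 + q ^ 4 - q ^ 3 - q ^ 2) := by
  have hA0 : A ≠ 0 := by simpa using hAc.ne_zero 0
  obtain ⟨w, hw, hcw⟩ := exists_mem_perp (q := q) hAc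
  obtain ⟨m, hm⟩ := quad_factor B (perp q A) (herm q c) (v := (herm q c w)⁻¹ • w)
    (Submodule.smul_mem _ _ hw) (by rw [map_smul, smul_eq_mul, inv_mul_cancel₀ hcw])
    (fun x hx => hc x hx)
  have hmA : m A = 0 := by
    have h1 := hm (A + w) (Submodule.add_mem _ hA hw)
    have h2 := hm w hw
    have h3 := hm A hA
    have h4 := hS w hw
    simp only [map_add, LinearMap.add_apply, hcA, zero_mul, zero_add] at h1 h2 h3
    have : herm q c w * m A = 0 := by linear_combination h4 + h2 + h3 - h1
    exact (mul_eq_zero.1 this).resolve_left hcw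
  obtain ⟨c', rfl⟩ := exists_herm_eq (q := q) m
  have hAc' : LinearIndependent F ![A, c'] := by
    rw [LinearIndependent.pair_iff' hA0]
    rintro s rfl
    apply hBv
    rw [hm v hv, herm_smul_right, hv]; simp
  have key : ∀ b : V5 F, herm q b A = 0 → LinearIndependent F ![A, b] →
      cnt (fun z => (z ∈ perp q A ⊓ perp q b ∧ Iso q z) ∧ z ∉ Submodule.span F {A}) ≤
        (q : ℤ) ^ 5 + q ^ 4 - q ^ 3 - q ^ 2 := by
    intro b hb hAb
    have h1 := iso_perp_inf_le hA hb hAb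
    have h2 := cnt_split (fun z => z ∈ perp q A ⊓ perp q b ∧ Iso q z)
      (fun z => z ∈ Submodule.span F {A})
    have h3 : cnt (fun z => (z ∈ perp q A ⊓ perp q b ∧ Iso q z) ∧ z ∈ Submodule.span F {A}) =
        (q : ℤ) ^ 2 := by
      have := cnt_mem (q := q) (Submodule.span F {A})
      rw [finrank_span_singleton hA0, mul_one] at this
      rw [← this]
      refine cnt_congr fun y => ⟨fun h => h.2, fun h => ⟨?_, h⟩⟩
      obtain ⟨s, rfl⟩ := Submodule.mem_span_singleton.1 h
      exact ⟨Submodule.smul_mem _ _ ⟨hA, hb⟩, iso_smul s hA⟩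
    unfold iso at h1
    linarith
  have h1 := key c hcA hAc
  have h2 := key c' hmA hAc'
  have h3 := cnt_split (fun z => herm q A z = 0 ∧ Iso q z ∧ B z z = 0)
    (fun z => z ∈ Submodule.span F {A})
  have h4 : cnt (fun z => (herm q A z = 0 ∧ Iso q z ∧ B z z = 0) ∧ z ∈ Submodule.span F {A}) ≤
      (q : ℤ) ^ 2 := by
    have := cnt_mem (q := q) (Submodule.span F {A})
    rw [finrank_span_singleton hA0, mul_one] at this
    rw [← this]
    exact cnt_mono fun y h => h.2
  have h5 : cnt (fun z => (herm q A z = 0 ∧ Iso q z ∧ B z z = 0) ∧ z ∉ Submodule.span F {A}) ≤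
      cnt (fun z => (z ∈ perp q A ⊓ perp q c ∧ Iso q z) ∧ z ∉ Submodule.span F {A}) +
      cnt (fun z => (z ∈ perp q A ⊓ perp q c' ∧ Iso q z) ∧ z ∉ Submodule.span F {A}) := by
    refine le_trans (cnt_mono fun z => ?_) (cnt_or_le _ _)
    rintro ⟨⟨hz, hI, hB⟩, hs⟩
    rw [hm z hz] at hB
    rcases mul_eq_zero.1 hB with h | h
    · exact Or.inl ⟨⟨⟨hz, h⟩, hI⟩, hs⟩
    · exact Or.inr ⟨⟨⟨hz, h⟩, hI⟩, hs⟩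
  linarith

/-- The number of parameters `t` for which the point `u + t w - B(u + t w) P` is isotropic. -/
lemma cnt_param_le (B : V5 F →ₗ[F] V5 F →ₗ[F] F) {A P u w : V5 F} (hA : Iso q A) (hP : Iso q P)
    (hAP : LinearIndependent F ![A, P]) (hAP' : herm q A P = 0) (hAw : herm q A w = 0)
    (hw : ¬ ∃ s t : F, s • A + t • P = w) (hBw : B w w ≠ 0) :
    cnt (fun t : F => Iso q (u + t • w - B (u + t • w) (u + t • w) • P)) ≤ 2 * q + 1 := by
  have h7 := hq.seven_le
  set v0 := u - B u u • P with hv0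
  set v1 := w - (B u w + B w u) • P with hv1
  set v2 := - B w w • P with hv2
  have hv : ∀ t : F, u + t • w - B (u + t • w) (u + t • w) • P = v0 + t • v1 + t ^ 2 • v2 := by
    intro t
    simp only [hv0, hv1, hv2, map_add, map_smul, LinearMap.add_apply, LinearMap.smul_apply,
      smul_eq_mul]
    module
  have h22 : herm q v2 v2 = 0 := iso_smul (- B w w) hP
  let p : Polynomial F := .C (herm q v0 v0) + .C (herm q v0 v1) * .X + .C (herm q v0 v2) * .X ^ 2 +
    .C (herm q v1 v0) * .X ^ q + .C (herm q v1 v1) * .X ^ (q + 1) +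
    .C (herm q v1 v2) * .X ^ (q + 2) +
    .C (herm q v2 v0) * .X ^ (2 * q) + .C (herm q v2 v1) * .X ^ (2 * q + 1)
  have heval : ∀ t : F, p.eval t = herm q (v0 + t • v1 + t ^ 2 • v2) (v0 + t • v1 + t ^ 2 • v2) := by
    intro t
    simp only [p, Polynomial.eval_add, Polynomial.eval_mul, Polynomial.eval_C, Polynomial.eval_X,
      Polynomial.eval_pow, herm_add_right, herm_smul_right, map_add, map_smul, smul_eq_mul, h22]
    ring
  have hdeg : p.natDegree ≤ 2 * q + 1 := by
    have h1 : ∀ (c : F) (n : ℕ), n ≤ 2 * q + 1 →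
        (Polynomial.C c * Polynomial.X ^ n).natDegree ≤ 2 * q + 1 := fun c n hn =>
      (Polynomial.natDegree_C_mul_X_pow_le c n).trans hn
    have hX : (Polynomial.C (herm q v0 v1) * Polynomial.X).natDegree ≤ 2 * q + 1 := by
      have := h1 (herm q v0 v1) 1 (by omega)
      rwa [pow_one] at this
    have hC : (Polynomial.C (herm q v0 v0)).natDegree ≤ 2 * q + 1 := by
      rw [Polynomial.natDegree_C]; omega
    refine Polynomial.natDegree_add_le_of_degree_le (Polynomial.natDegree_add_le_of_degree_le
      (Polynomial.natDegree_add_le_of_degree_le (Polynomial.natDegree_add_le_of_degree_le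
      (Polynomial.natDegree_add_le_of_degree_le (Polynomial.natDegree_add_le_of_degree_le
      (Polynomial.natDegree_add_le_of_degree_le hC hX) ?_) ?_) ?_) ?_) ?_) ?_ <;>
    exact h1 _ _ (by omega)
  have hp0 : p ≠ 0 := by
    intro hp
    have c2 : p.coeff (q + 2) = herm q v1 v2 := by
      simp only [p, Polynomial.coeff_add, Polynomial.coeff_C_mul, Polynomial.coeff_X_pow,
        Polynomial.coeff_X, Polynomial.coeff_C]
      rw [if_neg (by omega), if_neg (by omega), if_neg (by omega), if_neg (by omega),
        if_neg (by omega), if_pos trivial, if_neg (by omega), if_neg (by omega)]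
      ring
    have c1 : p.coeff (q + 1) = herm q v1 v1 := by
      simp only [p, Polynomial.coeff_add, Polynomial.coeff_C_mul, Polynomial.coeff_X_pow,
        Polynomial.coeff_X, Polynomial.coeff_C]
      rw [if_neg (by omega), if_neg (by omega), if_neg (by omega), if_neg (by omega),
        if_pos trivial, if_neg (by omega), if_neg (by omega), if_neg (by omega)]
      ring
    rw [hp, Polynomial.coeff_zero] at c1 c2
    have hPP : herm q P P = 0 := hP
    have h1 : herm q v1 P = 0 := by
      rw [hv2, map_smul, smul_eq_mul] at c2
      exact (mul_eq_zero.1 c2.symm).resolve_left (neg_ne_zero.2 hBw)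
    have h2 : herm q w P = 0 := by
      have : w = v1 + (B u w + B w u) • P := by rw [hv1, sub_add_cancel]
      rw [this, herm_add_right, h1, herm_smul_right, hPP]; simp
    have h3 : Iso q w := by
      have : w = v1 + (B u w + B w u) • P := by rw [hv1, sub_add_cancel]
      rw [this]
      exact iso_add c1.symm (iso_smul _ hP) (by rw [map_smul, h1, smul_zero])
    exact hw (mem_span_of_gamma hA hP hAP' hAP h3 hAw (herm_symm.1 h2))
  have := cnt_root_le hp0 hdeg
  push_cast at this
  refine le_trans (le_of_eq (cnt_congr fun t => ?_)) this
  rw [heval, hv]; rfl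

lemma cnt_span_pair {A P : V5 F} (hAP : LinearIndependent F ![A, P]) :
    cnt (fun z => ∃ s t : F, s • A + t • P = z) = (q : ℤ) ^ 4 := by
  have := cnt_mem (q := q) (Submodule.span F (Set.range ![A, P]))
  rw [finrank_span_eq_card hAP, Fintype.card_fin] at this
  rw [← this]
  refine cnt_congr fun z => ?_
  rw [Matrix.range_cons, Matrix.range_cons, Matrix.range_empty, Set.union_empty,
    Set.singleton_union, Submodule.mem_span_pair]

/-- The parametrised case of the bound for a cone over a conic. -/
lemma conic_of_param (B : V5 F →ₗ[F] V5 F →ₗ[F] F) {A P u : V5 F} (hA : Iso q A)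
    (hP : Iso q P) (hAP : LinearIndependent F ![A, P]) (hHAP : herm q A P = 0) (hBA : B A A = 0)
    (hBP : B P P = 0) (hS : ∀ y, herm q A y = 0 → B A y + B y A = 0)
    (hi : ∀ e, herm q A e = 0 → (¬ ∃ s t : F, s • A + t • P = e) → B P e + B e P = 0 → B e e ≠ 0)
    (hu : herm q A u = 0) (hbu : B P u + B u P = 1) :
    cnt (fun z => herm q A z = 0 ∧ Iso q z ∧ B z z = 0) ≤
      (q : ℤ) ^ 2 + 2 * (q ^ 5 + q ^ 4 - q ^ 3 - q ^ 2) := by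
  have hA0 : A ≠ 0 := by simpa using hAP.ne_zero 0
  set b : V5 F →ₗ[F] F := B P + B.flip P with hb
  have hbv : ∀ x, b x = B P x + B x P := fun x => rfl
  have hW : finrank F (perp q A ⊓ LinearMap.ker b : Submodule F (V5 F)) = 3 := by
    have h1 := finrank_inf_ker (perp q A) b (v := u) hu (by rw [hbv, hbu]; exact one_ne_zero)
    rw [finrank_perp hA0] at h1
    omega
  have hAW : A ∈ perp q A ⊓ LinearMap.ker b := ⟨hA, by
    change b A = 0
    rw [hbv, add_comm, hS P hHAP]⟩
  have hPW : P ∈ perp q A ⊓ LinearMap.ker b := ⟨hHAP, by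
    change b P = 0
    rw [hbv, hBP, add_zero]⟩
  obtain ⟨w, hwW, hw⟩ : ∃ w ∈ perp q A ⊓ LinearMap.ker b, ¬ ∃ s t : F, s • A + t • P = w := by
    by_contra! h
    have hle : perp q A ⊓ LinearMap.ker b ≤ Submodule.span F (Set.range ![A, P]) := by
      intro x hx
      rw [Matrix.range_cons, Matrix.range_cons, Matrix.range_empty, Set.union_empty,
        Set.singleton_union, Submodule.mem_span_pair]
      exact h x hx
    have := Submodule.finrank_mono hle
    rw [hW, finrank_span_eq_card hAP, Fintype.card_fin] at this
    omega
  have hAw : herm q A w = 0 := hwW.1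
  have hbw : B P w + B w P = 0 := hwW.2
  have hBw := hi w hAw hw hbw
  have hpar := cnt_param_le B (u := u) hA hP hAP hHAP hAw hw hBw
  have hcover : cnt (fun z => herm q A z = 0 ∧ Iso q z ∧ B z z = 0) ≤
      cnt (fun z => ∃ s t : F, s • A + t • P = z) +
      cnt (fun z => (herm q A z = 0 ∧ Iso q z ∧ B z z = 0) ∧ ¬ ∃ s t : F, s • A + t • P = z) := by
    rw [cnt_split (fun z => herm q A z = 0 ∧ Iso q z ∧ B z z = 0)
      (fun z => ∃ s t : F, s • A + t • P = z)]
    refine add_le_add_left (cnt_mono fun z h => h.2) _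
  have hprod : cnt (fun x : F × F × F => x.1 ≠ 0 ∧ Iso q (u + x.2.2 • w -
      B (u + x.2.2 • w) (u + x.2.2 • w) • P)) = ((q : ℤ) ^ 2 - 1) * (q ^ 2 *
      cnt (fun t : F => Iso q (u + t • w - B (u + t • w) (u + t • w) • P))) := by
    rw [cnt_pair (fun (s : F) (x : F × F) => s ≠ 0 ∧ Iso q (u + x.2 • w -
      B (u + x.2 • w) (u + x.2 • w) • P)), ← cnt_ne_zero_field (q := q) (F := F), ← sum_ite_const_eq]
    refine sum_congr rfl fun s _ => ?_
    split_ifs with hs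
    · simp only [hs, true_and, ne_eq, not_false_eq_true]
      rw [cnt_pair (fun (_ : F) (t : F) => Iso q (u + t • w -
        B (u + t • w) (u + t • w) • P)), sum_const, card_univ, hq.card, nsmul_eq_mul]
      push_cast; rfl
    · simp [hs, cnt]
  have hsurj : cnt (fun z => (herm q A z = 0 ∧ Iso q z ∧ B z z = 0) ∧
      ¬ ∃ s t : F, s • A + t • P = z) ≤ cnt (fun x : F × F × F => x.1 ≠ 0 ∧
        Iso q (u + x.2.2 • w - B (u + x.2.2 • w) (u + x.2.2 • w) • P)) := by
    refine cnt_le_of_surj (fun x : F × F × F => x.1 • (u + x.2.2 • w -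
      B (u + x.2.2 • w) (u + x.2.2 • w) • P + x.2.1 • A)) ?_
    rintro z ⟨⟨hz, hzI, hzB⟩, hzs⟩
    set s := b z with hs
    have hs0 : s ≠ 0 := fun h0 => hi z hz hzs h0 hzB
    have hzu : s⁻¹ • z - u ∈ perp q A ⊓ LinearMap.ker b := by
      refine ⟨Submodule.sub_mem _ (Submodule.smul_mem _ _ hz) hu, ?_⟩
      change b (s⁻¹ • z - u) = 0
      rw [map_sub, map_smul, hbv u, hbu, ← hs, smul_eq_mul, inv_mul_cancel₀ hs0, sub_self]
    obtain ⟨t, α, β, hzc⟩ := exists_comb_of_finrank_three hW hAP hw hAW hPW hwW hzu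
    have hz' : s⁻¹ • z = u + t • w + β • P + α • A := by
      rw [← sub_add_cancel (s⁻¹ • z) u, hzc]; module
    set y := u + t • w with hy
    have hAy : herm q A y = 0 := by rw [hy, map_add, map_smul, hu, hAw]; simp
    have hBy : B P y + B y P = 1 := by
      rw [hy, map_add, map_add, map_smul, map_smul, LinearMap.add_apply, LinearMap.smul_apply]
      simp only [smul_eq_mul]
      linear_combination hbu + t * hbw
    have hβ : β = - B y y := by
      have h1 : B (s⁻¹ • z) (s⁻¹ • z) = 0 := by simp [hzB]
      rw [hz'] at h1
      simp only [map_add, map_smul, LinearMap.add_apply, LinearMap.smul_apply, smul_eq_mul] at h1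
      linear_combination h1 - β * hBy - β ^ 2 * hBP - α ^ 2 * hBA - α * hS y hAy -
        α * β * hS P hHAP
    refine ⟨(s, α, t), ⟨hs0, ?_⟩, ?_⟩
    · change Iso q (y - B y y • P)
      have h1 : y - B y y • P = s⁻¹ • z + (-α) • A := by
        rw [hz', hβ]; module
      rw [h1]
      refine iso_comb hzI hA (herm_symm.1 hz) _ _
    · change s • (y - B y y • P + α • A) = z
      have h1 : y - B y y • P + α • A = s⁻¹ • z := by rw [hz', hβ]; module
      rw [h1, smul_inv_smul₀ hs0]
  rw [cnt_span_pair (q := q) hAP] at hcover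
  rw [hprod] at hsurj
  have h7 := q_ge (q := q) (F := F)
  have h8 : ((q : ℤ) ^ 2 - 1) * (q ^ 2 *
      cnt (fun t : F => Iso q (u + t • w - B (u + t • w) (u + t • w) • P))) ≤
      ((q : ℤ) ^ 2 - 1) * (q ^ 2 * (2 * q + 1)) := by
    refine mul_le_mul_of_nonneg_left (mul_le_mul_of_nonneg_left hpar (by positivity)) ?_
    nlinarith
  nlinarith

/-- A quadratic cone with vertex an isotropic vector `A` contains few isotropic vectors of the
hyperplane orthogonal to `A`. -/
lemma conic_bound (B : V5 F →ₗ[F] V5 F →ₗ[F] F) {A v : V5 F} (hA0 : A ≠ 0) (hA : Iso q A)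
    (hBA : B A A = 0) (hS : ∀ y, herm q A y = 0 → B A y + B y A = 0)
    (hv : herm q A v = 0) (hBv : B v v ≠ 0) :
    cnt (fun z => herm q A z = 0 ∧ Iso q z ∧ B z z = 0) ≤
      (q : ℤ) ^ 2 + 2 * (q ^ 5 + q ^ 4 - q ^ 3 - q ^ 2) := by
  have h7 := q_ge (q := q) (F := F)
  have h3 : (0 : ℤ) < q ^ 3 := by positivity
  have h4 : (0 : ℤ) < q ^ 4 := by positivity
  have hq54 : (q : ℤ) ^ 5 + q ^ 4 - q ^ 3 - q ^ 2 = q ^ 2 * ((q ^ 2 - 1) * (q + 1)) := by ring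
  have h2 : (0 : ℤ) < q ^ 2 - 1 := by nlinarith
  have hpos : (0 : ℤ) ≤ q ^ 5 + q ^ 4 - q ^ 3 - q ^ 2 := by
    rw [hq54]; positivity
  by_cases hK : ∃ P, (herm q A P = 0 ∧ Iso q P ∧ B P P = 0) ∧ P ∉ Submodule.span F {A}
  swap
  · push Not at hK
    have := cnt_mem (q := q) (Submodule.span F {A})
    rw [finrank_span_singleton hA0, mul_one] at this
    have h5 := cnt_mono hK
    linarith
  obtain ⟨P, ⟨hAP, hP, hBP⟩, hPA⟩ := hK
  have hind : LinearIndependent F ![A, P] := by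
    rw [LinearIndependent.pair_iff' hA0]
    rintro c rfl
    exact hPA (Submodule.smul_mem _ _ (Submodule.mem_span_singleton_self A))
  by_cases hi : ∃ e, herm q A e = 0 ∧ (¬ ∃ s t : F, s • A + t • P = e) ∧ B P e + B e P = 0 ∧
      B e e = 0
  · obtain ⟨e, hAe, he, hPe, hBe⟩ := hi
    have hl : LinearIndependent F ![e, A, P] := by
      refine linearIndependent_finCons.2 ⟨hind, fun h => he ?_⟩
      rwa [Matrix.range_cons, Matrix.range_cons, Matrix.range_empty, Set.union_empty,
        Set.singleton_union, Submodule.mem_span_pair] at h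
    set W := Submodule.span F (Set.range ![e, A, P]) with hWdef
    have hW : finrank F W = 3 := by rw [hWdef, finrank_span_eq_card hl, Fintype.card_fin]
    have heW : e ∈ W := Submodule.subset_span ⟨0, rfl⟩
    have hAW : A ∈ W := Submodule.subset_span ⟨1, rfl⟩
    have hPW : P ∈ W := Submodule.subset_span ⟨2, rfl⟩
    have hBW : ∀ (r s t : F), B (r • e + (s • A + t • P)) (r • e + (s • A + t • P)) = 0 := by
      intro r s t
      simp only [map_add, map_smul, LinearMap.add_apply, LinearMap.smul_apply, smul_eq_mul]
      linear_combination r ^ 2 * hBe + s ^ 2 * hBA + t ^ 2 * hBP + r * s * hS e hAe +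
        s * t * hS P hAP + r * t * hPe
    have hvW : v ∉ W := by
      intro h
      obtain ⟨r, s, t, rfl⟩ := exists_comb_of_finrank_three hW hind he hAW hPW heW h
      exact hBv (hBW r s t)
    obtain ⟨φ, hφ, hφW⟩ := Submodule.exists_dual_map_eq_bot_of_notMem hvW inferInstance
    obtain ⟨c, rfl⟩ := exists_herm_eq (q := q) φ
    have hcW : ∀ x ∈ W, herm q c x = 0 := by
      intro x hx
      have : herm q c x ∈ W.map (herm q c) := Submodule.mem_map_of_mem hx
      rwa [hφW, Submodule.mem_bot] at this
    have hAc : LinearIndependent F ![A, c] := by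
      rw [LinearIndependent.pair_iff' hA0]
      rintro s rfl
      rw [herm_smul_right, hv, mul_zero] at hφ
      exact hφ rfl
    refine conic_of_plane B hA hS hv hBv (hcW A hAW) hAc fun x hx hx' => ?_
    obtain ⟨r, s, t, rfl⟩ := exists_comb_of_finrank_three (finrank_perp_inf (q := q) hAc) hind he
      ⟨hA, hcW A hAW⟩ ⟨hAP, hcW P hPW⟩ ⟨hAe, hcW e heW⟩ (x := x) ⟨hx, hx'⟩
    exact hBW r s t
  · push Not at hi
    have hi' : ∀ e, herm q A e = 0 → (¬ ∃ s t : F, s • A + t • P = e) → B P e + B e P = 0 →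
        B e e ≠ 0 := by
      intro e h1 h2
      exact hi e h1 (by simpa using h2)
    by_cases hu : ∃ u, herm q A u = 0 ∧ B P u + B u P ≠ 0
    · obtain ⟨u, hAu, hbu⟩ := hu
      refine conic_of_param B (u := (B P u + B u P)⁻¹ • u) hA hP hind hAP hBA hBP hS hi' ?_ ?_
      · rw [map_smul, hAu, smul_zero]
      · simp only [map_smul, LinearMap.smul_apply, smul_eq_mul]
        rw [← mul_add, inv_mul_cancel₀ hbu]
    · push Not at hu
      have h5 : cnt (fun z => herm q A z = 0 ∧ Iso q z ∧ B z z = 0) ≤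
          cnt (fun z => ∃ s t : F, s • A + t • P = z) := by
        refine cnt_mono fun z hz => ?_
        by_contra hno
        exact hi' z hz.1 hno (hu z hz.1) hz.2.2
      rw [cnt_span_pair (q := q) hind] at h5
      nlinarith

end Conic

lemma cnt_eq_one {α : Type} [Fintype α] (a : α) : cnt (fun x => x = a) = 1 := by
  rw [cnt_eq_sum]; simp

lemma pair_of_ne_smul {F : Type} [Field F] {a b : V5 F} (ha : a ≠ 0) (h : ∀ s : F, s • a ≠ b) :
    LinearIndependent F ![a, b] := (LinearIndependent.pair_iff' ha).2 h

section Hyperplanes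

variable {q : ℕ} {F : Type} [Field F] [Fintype F] [hq : HermField q F]

include hq

lemma exists_q_eq : ∃ k : ℤ, 0 ≤ k ∧ (q : ℤ) = k + 7 := 
  ⟨q - 7, by linarith [q_ge (q := q) (F := F)], by ring⟩

lemma iso_perp_le {c : V5 F} (hc : c ≠ 0) : iso q (perp q c) ≤ (q : ℤ) ^ 7 + q ^ 4 - q ^ 3 := by
  obtain ⟨k, hk, hqk⟩ := exists_q_eq (q := q) (F := F)
  by_cases h : Iso q c
  · rw [iso_perp_of_iso hc h, hqk, ← sub_nonneg]
    ring_nf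
    positivity
  · rw [iso_perp_of_not_iso h]

lemma cnt_span_singleton {a : V5 F} (ha : a ≠ 0) :
    cnt (fun x => ∃ s : F, s • a = x) = (q : ℤ) ^ 2 := by
  have := cnt_mem (q := q) (Submodule.span F {a})
  rw [finrank_span_singleton ha] at this
  rw [← this]
  exact cnt_congr fun x => Submodule.mem_span_singleton.symm

lemma cnt_perp_diff_le {a b : V5 F} (ha : a ≠ 0) (hb : b ≠ 0) {k : ℤ}
    (hk : iso q (perp q b) ≤ k) (hk2 : (q : ℤ) ^ 2 ≤ k) :
    cnt (fun x => Iso q x ∧ herm q b x = 0 ∧ herm q a x ≠ 0) ≤ k - q ^ 2 := by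
  by_cases h : ∃ s : F, s • b = a
  · obtain ⟨s, rfl⟩ := h
    have : cnt (fun x => Iso q x ∧ herm q b x = 0 ∧ herm q (s • b) x ≠ 0) = 0 := by
      rw [cnt_eq_sum]
      refine sum_eq_zero fun x _ => if_neg ?_
      rintro ⟨-, h1, h2⟩
      rw [herm_smul_right, h1, mul_zero] at h2
      exact h2 rfl
    linarith
  · push Not at h
    have h1 := le_iso_perp_inf (q := q) (pair_of_ne_smul hb h)
    have h2 := cnt_split (fun x => x ∈ perp q b ∧ Iso q x) (fun x => herm q a x = 0)
    have h3 : cnt (fun x => (x ∈ perp q b ∧ Iso q x) ∧ herm q a x = 0) =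
        iso q (perp q b ⊓ perp q a) := by
      refine cnt_congr fun x => ?_
      simp only [Submodule.mem_inf, mem_perp]; tauto
    have h4 : cnt (fun x => (x ∈ perp q b ∧ Iso q x) ∧ ¬ herm q a x = 0) =
        cnt (fun x => Iso q x ∧ herm q b x = 0 ∧ herm q a x ≠ 0) := by
      refine cnt_congr fun x => ?_
      simp only [mem_perp]; tauto
    unfold iso at hk h1
    unfold iso at h3
    linarith

/-- Two tangent hyperplanes and a third hyperplane. -/
lemma three_hyperplanes {a b c : V5 F} (ha : a ≠ 0) (haI : Iso q a) (hb : b ≠ 0) (hbI : Iso q b)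
    (hc : c ≠ 0) :
    cnt (fun x => Iso q x ∧ herm q a x * (herm q b x * herm q c x) = 0) ≤
      1 + ((q : ℤ) ^ 2 - 1) * (3 * q ^ 5 + q ^ 3 + 3 * q ^ 2 + 1) := by
  obtain ⟨k, hk, hqk⟩ := exists_q_eq (q := q) (F := F)
  have h1 : cnt (fun x => Iso q x ∧ herm q a x = 0) = (q : ℤ) ^ 7 - q ^ 5 + q ^ 4 := by
    rw [← iso_perp_of_iso ha haI]
    exact cnt_congr fun x => and_comm
  have h2 := cnt_perp_diff_le ha hb (iso_perp_of_iso hb hbI).le (by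
    rw [hqk, ← sub_nonneg]; ring_nf; positivity)
  have h3 := cnt_perp_diff_le ha hc (iso_perp_le hc) (by
    rw [hqk, ← sub_nonneg]; ring_nf; positivity)
  have h4 : cnt (fun x => Iso q x ∧ herm q a x * (herm q b x * herm q c x) = 0) ≤
      cnt (fun x => (Iso q x ∧ herm q a x = 0) ∨ (Iso q x ∧ herm q b x = 0 ∧ herm q a x ≠ 0) ∨
        (Iso q x ∧ herm q c x = 0 ∧ herm q a x ≠ 0)) := by
    refine cnt_mono fun x hx => ?_
    simp only [mul_eq_zero] at hx
    tauto
  have h5 := cnt_or_le (fun x => Iso q x ∧ herm q a x = 0) (fun x =>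
    (Iso q x ∧ herm q b x = 0 ∧ herm q a x ≠ 0) ∨ (Iso q x ∧ herm q c x = 0 ∧ herm q a x ≠ 0))
  have h6 := cnt_or_le (fun x => Iso q x ∧ herm q b x = 0 ∧ herm q a x ≠ 0)
    (fun x => Iso q x ∧ herm q c x = 0 ∧ herm q a x ≠ 0)
  linarith

end Hyperplanes

section Counts

variable {q : ℕ} {F : Type} [Field F] [Fintype F] (B : V5 F →ₗ[F] V5 F →ₗ[F] F)

/-- Isotropic vectors orthogonal to `a` and independent of it. -/
def Jset (q : ℕ) {F : Type} [Field F] (a A : V5 F) : Prop :=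
  Iso q A ∧ herm q a A = 0 ∧ LinearIndependent F ![A, a]

/-- The zeros of the quadric orthogonal to `A` but not to `a`. -/
def cval (q : ℕ) {F : Type} [Field F] [Fintype F] (B : V5 F →ₗ[F] V5 F →ₗ[F] F) (a A : V5 F) : ℤ :=
  cnt (fun z => (herm q A z = 0 ∧ Iso q z ∧ herm q a z ≠ 0) ∧ B z z = 0)

/-- The part of the bad locus of `A` outside the hyperplane orthogonal to `a`. -/
def badOut (q : ℕ) {F : Type} [Field F] [Fintype F] (B : V5 F →ₗ[F] V5 F →ₗ[F] F) (a A : V5 F) : ℤ :=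
  cnt (fun z => (herm q A z = 0 ∧ Iso q z ∧ herm q a z ≠ 0) ∧ (quadForm B).Bad A z)

lemma badOut_add (a A : V5 F) :
    (quadForm B).bad q (perp q a) A + badOut q B a A = (quadForm B).bad q ⊤ A := by
  unfold Form.bad badOut
  rw [cnt_split (fun y => y ∈ ⊤ ⊓ perp q A ∧ _) (fun z => herm q a z = 0)]
  congr 1 <;> refine cnt_congr fun x => ?_ <;> simp only [Submodule.mem_inf, mem_perp,
    Submodule.mem_top, true_and] <;> tauto

/-- The number of isotropic vectors orthogonal to `A` but not to `a`. -/
def kap (q : ℕ) {F : Type} [Field F] [Fintype F] (a A : V5 F) : ℤ :=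
  cnt (fun z => herm q A z = 0 ∧ Iso q z ∧ herm q a z ≠ 0)

lemma kap_eq (a A : V5 F) : iso q (perp q A ⊓ perp q a) + kap q a A = iso q (perp q A) := by
  unfold kap iso
  rw [cnt_split (fun x => x ∈ perp q A ∧ Iso q x) (fun z => herm q a z = 0)]
  congr 1 <;> refine cnt_congr fun x => ?_ <;> simp only [Submodule.mem_inf, mem_perp] <;> tauto

lemma badOut_nonneg (a A : V5 F) : 0 ≤ badOut q B a A := cnt_nonneg _

lemma cval_le_of_sing {a A : V5 F} (hBA : B A A = 0) (hS : (quadForm B).Sing q A) :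
    cval q B a A ≤ badOut q B a A := by
  refine cnt_mono fun z hz => ⟨hz.1, fun s t => ?_⟩
  have h := hS z hz.1.1
  change B A z + B z A = 0 at h
  change B (s • A + t • z) (s • A + t • z) = 0
  simp only [map_add, map_smul, LinearMap.add_apply, LinearMap.smul_apply, smul_eq_mul]
  linear_combination s ^ 2 * hBA + t ^ 2 * hz.2 + s * t * h

end Counts

section Quadric

variable {q : ℕ} {F : Type} [Field F] [Fintype F] [hq : HermField q F]
  (B : V5 F →ₗ[F] V5 F →ₗ[F] F)

include hq

/-- Translating a quadric along the direction of one of its points. -/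
lemma quad_fiber_le (Ω : V5 F → Prop) {A : V5 F} (hA : B A A = 0)
    (hΩ : ∀ x (t : F), Ω x → Ω (x + t • A)) :
    (q : ℤ) ^ 2 * cnt (fun x => Ω x ∧ B x x = 0) ≤
      cnt Ω + (q ^ 2 - 1) * cnt (fun x => Ω x ∧ (quadForm B).Bad A x) := by
  rw [translate Ω (fun x => B x x = 0) A hΩ, cnt_eq_sum Ω, cnt_eq_sum (fun x => _ ∧ _), mul_sum,
    ← sum_add_distrib]
  refine sum_le_sum fun x _ => ?_
  by_cases hx : Ω x
  swap
  · simp [hx]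
  by_cases hb : (quadForm B).Bad A x
  · simp only [hx, hb, if_true, and_self]
    refine (cnt_mono (Q := fun _ => True) fun _ _ => trivial).trans ?_
    rw [cnt_univ_field (q := q)]
    linarith
  · simp only [hx, hb, if_true, and_false, if_false]
    rw [mul_zero, add_zero]
    have hev : ∀ t : F, B (x + t • A) (x + t • A) = B x x + t * (B x A + B A x) := by
      intro t
      simp only [map_add, map_smul, LinearMap.add_apply, LinearMap.smul_apply, smul_eq_mul, hA]
      ring
    by_cases hD : B x A + B A x = 0
    · have : cnt (fun t : F => B (x + t • A) (x + t • A) = 0) = 0 := by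
        rw [cnt_eq_sum]
        refine sum_eq_zero fun t _ => if_neg fun h => hb ?_
        rw [hev, hD, mul_zero, add_zero] at h
        intro s t
        change B (s • A + t • x) (s • A + t • x) = 0
        simp only [map_add, map_smul, LinearMap.add_apply, LinearMap.smul_apply, smul_eq_mul, hA]
        linear_combination t ^ 2 * h + s * t * hD
      linarith
    · have : cnt (fun t : F => B (x + t • A) (x + t • A) = 0) ≤
          cnt (fun t : F => t = -B x x / (B x A + B A x)) := by
        refine cnt_mono fun t ht => ?_
        rw [hev] at ht
        rw [eq_div_iff hD]
        linear_combination ht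
      exact this.trans (cnt_eq_one _).le

lemma bad_le_of_not_sing {A : V5 F} (hA0 : A ≠ 0) (hA : Iso q A) (hBA : B A A = 0)
    (hS : ¬ (quadForm B).Sing q A) : (quadForm B).bad q ⊤ A ≤ (q : ℤ) ^ 5 + q ^ 4 - q ^ 3 := by
  obtain ⟨b, hb⟩ := (quadForm B).exists_reg hA0 hA hBA hS
  exact ((quadForm B).bad_le_of_reg (by norm_num) hb).trans (iso_perp_inf_le hA hb.2.2.2.1 hb.2.2.2.2)

lemma bad_le_of_sing {A v : V5 F} (hA0 : A ≠ 0) (hA : Iso q A) (hBA : B A A = 0)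
    (hS : (quadForm B).Sing q A) (hv : herm q A v = 0) (hBv : B v v ≠ 0) :
    (quadForm B).bad q ⊤ A ≤ (q : ℤ) ^ 2 + 2 * (q ^ 5 + q ^ 4 - q ^ 3 - q ^ 2) := by
  refine le_trans ?_ (conic_bound B hA0 hA hBA (fun y hy => hS y hy) hv hBv)
  refine cnt_mono fun z hz => ⟨hz.1.2, hz.2.1, ?_⟩
  have := hz.2.2 0 1
  simpa [quadForm] using this

lemma double_count (a : V5 F) :
    cnt (fun z => Iso q z ∧ herm q a z ≠ 0 ∧ B z z = 0) * (((q : ℤ) ^ 2 - 1) * (q ^ 3 + 1)) =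
      ∑ A, if Jset q a A then cval q B a A else 0 := by
  have h1 : ∀ A, (if Jset q a A then cval q B a A else 0) = cnt (fun z => Jset q a A ∧
      ((herm q A z = 0 ∧ Iso q z ∧ herm q a z ≠ 0) ∧ B z z = 0)) := by
    intro A
    by_cases h : Jset q a A
    · simp [h, cval]
    · simp [h, cnt]
  simp only [h1]
  rw [sum_cnt_comm, ← sum_ite_const_eq]
  refine sum_congr rfl fun z _ => ?_
  split_ifs with hz
  · obtain ⟨hzI, hza, hBz⟩ := hz
    have hβ := iso_perp_inf_beta (z := z) (a := a) hzI (fun h => hza (herm_symm.1 h))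
    have h2 := cnt_split (fun x => x ∈ perp q a ⊓ perp q z ∧ Iso q x) (fun x => x = 0)
    have h3 : cnt (fun x => (x ∈ perp q a ⊓ perp q z ∧ Iso q x) ∧ x = 0) = 1 := by
      rw [← cnt_eq_one (0 : V5 F)]
      refine cnt_congr fun x => ⟨fun h => h.2, ?_⟩
      rintro rfl
      exact ⟨⟨Submodule.zero_mem _, iso_zero q⟩, rfl⟩
    have h4 : cnt (fun x => (x ∈ perp q a ⊓ perp q z ∧ Iso q x) ∧ ¬ x = 0) =
        cnt (fun A => Jset q a A ∧ ((herm q A z = 0 ∧ Iso q z ∧ herm q a z ≠ 0) ∧ B z z = 0)) := by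
      refine cnt_congr fun A => ?_
      constructor
      · rintro ⟨⟨⟨h5, h6⟩, h7⟩, h8⟩
        refine ⟨⟨h7, h5, ?_⟩, ⟨herm_symm.1 h6, hzI, hza⟩, hBz⟩
        rw [LinearIndependent.pair_iff' h8]
        rintro s rfl
        rw [herm_smul_right, herm_symm.1 h6, mul_zero] at hza
        exact hza rfl
      · rintro ⟨⟨h5, h6, h7⟩, ⟨h8, -⟩, -⟩
        exact ⟨⟨⟨h6, herm_symm.1 h8⟩, h5⟩, h7.ne_zero 0⟩
    unfold iso at hβ
    linarith
  · symm
    simp only [cnt_eq_sum]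
    refine sum_eq_zero fun A _ => if_neg ?_
    tauto

lemma le_bad {U : Submodule F (V5 F)} {A : V5 F} (hA0 : A ≠ 0) (hA : Iso q A) (hAU : A ∈ U)
    (hBA : B A A = 0) :
    (q : ℤ) ^ 2 ≤ (quadForm B).bad q U A := by
  rw [← cnt_span_singleton (q := q) hA0]
  refine cnt_mono ?_
  rintro _ ⟨s, rfl⟩
  refine ⟨⟨U.smul_mem _ hAU, ?_⟩, iso_smul s hA, fun t u => ?_⟩
  · change herm q A (s • A) = 0
    rw [map_smul, hA, smul_zero]
  · rw [smul_smul, ← add_smul, (quadForm B).smul]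
    change _ * B A A = 0
    rw [hBA, mul_zero]

lemma omega_add {a A : V5 F} (hA : Iso q A) (haA : herm q a A = 0) (x : V5 F) (t : F)
    (h : herm q A x = 0 ∧ Iso q x ∧ herm q a x ≠ 0) :
    herm q A (x + t • A) = 0 ∧ Iso q (x + t • A) ∧ herm q a (x + t • A) ≠ 0 := by
  obtain ⟨h1, h2, h3⟩ := h
  refine ⟨?_, ?_, ?_⟩
  · rw [map_add, map_smul, h1, hA]; simp
  · refine iso_add h2 (iso_smul t hA) ?_
    rw [map_smul, herm_symm.1 h1, smul_zero]
  · rw [map_add, map_smul, haA]; simpa using h3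

lemma cval_le_of_ne {a A : V5 F} (hA : Iso q A) (haA : herm q a A = 0) (hBA : B A A ≠ 0) :
    (q : ℤ) ^ 2 * cval q B a A ≤ 2 * kap q a A := by
  rw [mul_comm 2]
  exact translate_le _ _ A (omega_add hA haA) 2 fun x _ => by
    exact_mod_cast (quadForm B).cnt_line_le x hBA

lemma cval_le {a A : V5 F} (hA : Iso q A) (haA : herm q a A = 0) (hBA : B A A = 0) :
    (q : ℤ) ^ 2 * cval q B a A ≤ kap q a A + (q ^ 2 - 1) * badOut q B a A :=
  quad_fiber_le B _ hBA (omega_add hA haA)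

end Quadric

section Weights

variable {q d : ℕ} {F : Type} [Field F] (Φ : Form d F)

lemma Form.wt_of_sing {x : V5 F} (h : Φ.f x = 0) (hS : Φ.Sing q x) : Φ.wt q x = 2 := by
  unfold Form.wt
  rw [if_pos h, if_pos hS]

lemma Form.wt_of_not_sing {x : V5 F} (h : Φ.f x = 0) (hS : ¬ Φ.Sing q x) : Φ.wt q x = 1 := by
  unfold Form.wt
  rw [if_pos h, if_neg hS]

lemma cnt_iso_ne_zero [Fintype F] (U : Submodule F (V5 F)) :
    cnt (fun x => x ∈ U ∧ x ≠ 0 ∧ Iso q x) = iso q U - 1 := by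
  unfold iso
  rw [cnt_split (fun x => x ∈ U ∧ Iso q x) (fun x => x = 0), ← cnt_eq_one (0 : V5 F),
    cnt_congr (P := fun x => (x ∈ U ∧ Iso q x) ∧ x = 0) (Q := fun x => x = 0)]
  · rw [add_sub_cancel_left]
    exact cnt_congr fun x => by tauto
  · refine fun x => ⟨fun h => h.2, ?_⟩
    rintro rfl
    exact ⟨⟨U.zero_mem, iso_zero q⟩, rfl⟩

end Weights

section Quadric

variable {q : ℕ} {F : Type} [Field F] [Fintype F] [hq : HermField q F]
  (B : V5 F →ₗ[F] V5 F →ₗ[F] F)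

include hq

lemma jset_iff_of_not_iso {a : V5 F} (ha : ¬ Iso q a) (A : V5 F) :
    Jset q a A ↔ A ∈ perp q a ∧ A ≠ 0 ∧ Iso q A := by
  constructor
  · rintro ⟨h1, h2, h3⟩
    exact ⟨h2, h3.ne_zero 0, h1⟩
  · rintro ⟨h2, h3, h1⟩
    refine ⟨h1, h2, pair_of_ne_smul h3 ?_⟩
    rintro s rfl
    exact ha (iso_smul s h1)

lemma cval_le_of_not_iso {a A v : V5 F} (ha : ¬ Iso q a) (hA0 : A ≠ 0) (hA : Iso q A)
    (haA : herm q a A = 0) (hv : herm q A v = 0) (hBv : B v v ≠ 0) :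
    (q : ℤ) ^ 2 * cval q B a A ≤ 2 * (q ^ 3 * (q ^ 2 - 1) ^ 2) + q * ((quadForm B).wt q A *
      (q ^ 5 + q ^ 4 - q ^ 3 - (quadForm B).bad q (perp q a) A)) := by
  obtain ⟨k, hk, hqk⟩ := exists_q_eq (q := q) (F := F)
  have hα := iso_perp_inf_alpha hA0 hA ha haA
  have hκ : kap q a A = q ^ 3 * (q ^ 2 - 1) ^ 2 := by
    have := kap_eq (q := q) a A
    rw [hα, iso_perp_of_iso hA0 hA] at this
    linear_combination this
  have hn : (quadForm B).bad q (perp q a) A ≤ q ^ 5 + q ^ 4 - q ^ 3 := by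
    rw [← hα, inf_comm]
    exact cnt_mono fun z hz => ⟨hz.1, hz.2.1⟩
  by_cases hBA : B A A = 0
  swap
  · have := cval_le_of_ne B hA haA hBA
    have hw : (quadForm B).wt q A = 0 := if_neg hBA
    rw [hw]
    linarith
  have hadd := badOut_add (q := q) B a A
  have h0 := badOut_nonneg (q := q) B a A
  have hle := le_bad B hA0 hA (U := perp q a) haA hBA
  set x := badOut q B a A
  set y := (quadForm B).bad q (perp q a) A
  by_cases hS : (quadForm B).Sing q A
  · have hw : (quadForm B).wt q A = 2 := (quadForm B).wt_of_sing hBA hS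
    have h1 := cval_le_of_sing B (a := a) hBA hS
    have h2 := bad_le_of_sing B hA0 hA hBA hS hv hBv
    rw [hw]
    have h3 : x ≤ 2 * (q ^ 5 + q ^ 4 - q ^ 3) - q ^ 2 - y := by linarith
    have h4 : (q : ℤ) ^ 2 * cval q B a A ≤ q ^ 2 * (2 * (q ^ 5 + q ^ 4 - q ^ 3) - q ^ 2 - y) :=
      mul_le_mul_of_nonneg_left (h1.trans h3) (by positivity)
    have h5 : 0 ≤ ((q : ℤ) ^ 2 - 2 * q) * (y - q ^ 2) := by
      refine mul_nonneg ?_ (by linarith)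
      rw [hqk]; ring_nf; positivity
    linarith
  · have hw : (quadForm B).wt q A = 1 := (quadForm B).wt_of_not_sing hBA hS
    have h1 := cval_le B hA haA hBA
    have h2 := bad_le_of_not_sing B hA0 hA hBA hS
    rw [hκ] at h1
    rw [hw]
    have h3 : ((q : ℤ) ^ 2 - 1 - q) * x ≤ (q ^ 2 - 1 - q) * (q ^ 5 + q ^ 4 - q ^ 3) := by
      refine mul_le_mul_of_nonneg_left (by linarith [sq_nonneg (q : ℤ)]) ?_
      rw [hqk]; ring_nf; positivity
    have h4 : (q : ℤ) * x ≤ q * (q ^ 5 + q ^ 4 - q ^ 3 - y) :=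
      mul_le_mul_of_nonneg_left (by linarith) (by positivity)
    have h5 : (0 : ℤ) ≤ q ^ 5 := by positivity
    linarith

lemma quadric_off_not_iso {a : V5 F} (ha : ¬ Iso q a)
    (hB : ∀ A, A ≠ 0 → Iso q A → ∃ v, herm q A v = 0 ∧ B v v ≠ 0) :
    cnt (fun z => Iso q z ∧ herm q a z ≠ 0 ∧ B z z = 0) ≤
      ((q : ℤ) ^ 2 - 1) * (2 * q ^ 5 + 2 * q ^ 2) := by
  obtain ⟨k, hk, hqk⟩ := exists_q_eq (q := q) (F := F)
  have hJ : cnt (Jset q a) = ((q : ℤ) ^ 4 - 1) * (q ^ 3 + 1) := by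
    rw [cnt_congr (jset_iff_of_not_iso ha), cnt_iso_ne_zero, iso_perp_of_not_iso ha]
    ring
  have h1 := double_count (q := q) B a
  have h2 := (quadForm B).weighted_le (q := q) le_rfl (perp q a) (q ^ 5 + q ^ 4 - q ^ 3)
    fun x hx hx0 hxI => by rw [inf_comm]; exact iso_perp_inf_alpha hx0 hxI ha hx
  rw [← cnt_congr (jset_iff_of_not_iso ha), hJ] at h2
  have h3 : (q : ℤ) ^ 2 * (∑ A, if Jset q a A then cval q B a A else 0) ≤
      cnt (Jset q a) * (2 * (q ^ 3 * (q ^ 2 - 1) ^ 2)) + q * ∑ x : V5 F,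
        (if x ∈ perp q a ∧ x ≠ 0 ∧ Iso q x then (quadForm B).wt q x *
          (q ^ 5 + q ^ 4 - q ^ 3 - (quadForm B).bad q (perp q a) x) else 0) := by
    rw [← sum_ite_const_eq, mul_sum, mul_sum, ← sum_add_distrib]
    refine sum_le_sum fun A _ => ?_
    rw [if_congr (jset_iff_of_not_iso ha A) rfl rfl, if_congr (jset_iff_of_not_iso ha A) rfl rfl]
    split_ifs with h
    · obtain ⟨v, hv, hBv⟩ := hB A h.2.1 h.2.2
      exact cval_le_of_not_iso B ha h.2.1 h.2.2 h.1 hv hBv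
    · simp
  rw [hJ, ← h1] at h3
  have h4 := mul_le_mul_of_nonneg_left h3 (show (0 : ℤ) ≤ q ^ 2 + 1 by positivity)
  have h5 := mul_le_mul_of_nonneg_left h2 (show (0 : ℤ) ≤ q by positivity)
  refine le_of_mul_le_mul_left (a := (q : ℤ) ^ 2 * ((q ^ 4 - 1) * (q ^ 3 + 1))) ?_ ?_
  · push_cast at h5
    linarith
  · rw [hqk]; ring_nf; positivity

lemma cnt_jset_of_iso {V : V5 F} (hV0 : V ≠ 0) (hV : Iso q V) :
    cnt (Jset q V) = ((q : ℤ) ^ 3 + 1) * (q ^ 4 - q ^ 2) := by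
  have h1 := iso_perp_of_iso hV0 hV
  unfold iso at h1
  rw [cnt_split (fun x => x ∈ perp q V ∧ Iso q x) (fun x => ∃ s : F, s • V = x),
    cnt_congr (P := fun x => (x ∈ perp q V ∧ Iso q x) ∧ _) (Q := fun x => ∃ s : F, s • V = x),
    cnt_span_singleton (q := q) hV0, cnt_congr (Q := Jset q V)] at h1
  · linarith
  · intro x
    unfold Jset
    rw [LinearIndependent.pair_symm_iff, LinearIndependent.pair_iff' hV0, mem_perp]
    push Not
    tauto
  · refine fun x => ⟨fun h => h.2, ?_⟩
    rintro ⟨s, rfl⟩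
    refine ⟨⟨?_, iso_smul s hV⟩, s, rfl⟩
    rw [mem_perp, map_smul, hV, smul_zero]

lemma cval_le_of_iso {V A v : V5 F} (hV : Iso q V) (hA : Jset q V A)
    (hv : herm q A v = 0) (hBv : B v v ≠ 0) :
    (q : ℤ) ^ 2 * cval q B V A ≤ 2 * (q ^ 7 - q ^ 5) +
      (quadForm B).wt q A * (q ^ 2 * (q ^ 4 - q ^ 2)) := by
  obtain ⟨k, hk, hqk⟩ := exists_q_eq (q := q) (F := F)
  obtain ⟨hA, hVA, hind⟩ := hA
  have hA0 : A ≠ 0 := hind.ne_zero 0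
  have hκ : kap q V A = q ^ 7 - q ^ 5 := by
    have := kap_eq (q := q) V A
    rw [iso_perp_inf_gamma hA hV (herm_symm.1 hVA) hind, iso_perp_of_iso hA0 hA] at this
    linear_combination this
  by_cases hBA : B A A = 0
  swap
  · have := cval_le_of_ne B hA hVA hBA
    have hw : (quadForm B).wt q A = 0 := if_neg hBA
    rw [hw]
    linarith
  have hadd := badOut_add (q := q) B V A
  have h0 := badOut_nonneg (q := q) B V A
  have hle := le_bad B hA0 hA (U := perp q V) hVA hBA
  set x := badOut q B V A
  set y := (quadForm B).bad q (perp q V) A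
  by_cases hS : (quadForm B).Sing q A
  · have hw : (quadForm B).wt q A = 2 := (quadForm B).wt_of_sing hBA hS
    have h1 := cval_le_of_sing B (a := V) hBA hS
    have h2 := bad_le_of_sing B hA0 hA hBA hS hv hBv
    rw [hw]
    have h4 : (q : ℤ) ^ 2 * cval q B V A ≤ q ^ 2 * (2 * (q ^ 5 + q ^ 4 - q ^ 3 - q ^ 2)) :=
      mul_le_mul_of_nonneg_left (by linarith) (by positivity)
    linarith
  · have hw : (quadForm B).wt q A = 1 := (quadForm B).wt_of_not_sing hBA hS
    have h1 := cval_le B hA hVA hBA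
    have h2 := bad_le_of_not_sing B hA0 hA hBA hS
    rw [hκ] at h1
    rw [hw]
    have h3 : ((q : ℤ) ^ 2 - 1) * x ≤ (q ^ 2 - 1) * (q ^ 5 + q ^ 4 - q ^ 3 - q ^ 2) := by
      refine mul_le_mul_of_nonneg_left (by linarith) ?_
      rw [hqk]; ring_nf; positivity
    have h5 : (0 : ℤ) ≤ q ^ 2 * (q ^ 2 - 1) * (q + 1) := by
      rw [hqk]; ring_nf; positivity
    linarith

lemma cnt_jset_zero_le {V v : V5 F} (hV0 : V ≠ 0) (hV : Iso q V) (hv : herm q V v = 0)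
    (hBv : B v v ≠ 0) :
    2 * cnt (fun A => Jset q V A ∧ B A A = 0) ≤ ((q : ℤ) ^ 2 - 1) * (q ^ 3 + 1) * (q + 2) := by
  obtain ⟨k, hk, hqk⟩ := exists_q_eq (q := q) (F := F)
  have hΩ : ∀ x (t : F), Jset q V x → Jset q V (x + t • V) := by
    rintro x t ⟨h1, h2, h3⟩
    refine ⟨?_, ?_, ?_⟩
    · refine iso_add h1 (iso_smul t hV) ?_
      rw [map_smul, herm_symm.1 h2, smul_zero]
    · rw [map_add, map_smul, h2, hV]; simp
    · rw [LinearIndependent.pair_symm_iff, LinearIndependent.pair_iff' hV0] at h3 ⊢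
      intro s hs
      refine h3 (s - t) ?_
      rw [sub_smul, hs, add_sub_cancel_right]
  have hJ := cnt_jset_of_iso hV0 hV
  by_cases hBV : B V V = 0
  · have h1 := quad_fiber_le (q := q) B _ hBV hΩ
    have h2 : cnt (fun x => Jset q V x ∧ (quadForm B).Bad V x) ≤ (quadForm B).bad q ⊤ V := by
      refine cnt_mono fun x hx => ⟨⟨trivial, hx.1.2.1⟩, hx.1.1, hx.2⟩
    have h3 : (quadForm B).bad q ⊤ V ≤ (q : ℤ) ^ 2 + 2 * (q ^ 5 + q ^ 4 - q ^ 3 - q ^ 2) := by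
      by_cases hS : (quadForm B).Sing q V
      · exact bad_le_of_sing B hV0 hV hBV hS hv hBv
      · refine (bad_le_of_not_sing B hV0 hV hBV hS).trans ?_
        rw [hqk, ← sub_nonneg]; ring_nf; positivity
    rw [hJ] at h1
    have h4 := mul_le_mul_of_nonneg_left (h2.trans h3) (show (0 : ℤ) ≤ q ^ 2 - 1 by
      rw [hqk]; ring_nf; positivity)
    have h5 : (0 : ℤ) ≤ q ^ 2 * (q ^ 2 - 1) * ((q ^ 3 + 1) * (q + 2) -
        2 * (q ^ 3 + 1 + 1 + 2 * (q ^ 3 + q ^ 2 - q - 1))) := by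
      rw [hqk]; ring_nf; positivity
    refine le_of_mul_le_mul_left (a := (q : ℤ) ^ 2) ?_ ?_
    · linarith
    · rw [hqk]; positivity
  · have h1 := translate_le (q := q) _ (fun x => B x x = 0) V hΩ 2 fun x _ => by
      exact_mod_cast (quadForm B).cnt_line_le x hBV
    rw [hJ] at h1
    have h5 : (0 : ℤ) ≤ q ^ 2 * (q ^ 2 - 1) * ((q ^ 3 + 1) * (q - 2)) := by
      rw [hqk]; ring_nf; positivity
    refine le_of_mul_le_mul_left (a := (q : ℤ) ^ 2) ?_ ?_
    · linarith
    · rw [hqk]; positivity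

lemma quadric_off_iso {V : V5 F} (hV0 : V ≠ 0) (hV : Iso q V)
    (hB : ∀ A, A ≠ 0 → Iso q A → ∃ v, herm q A v = 0 ∧ B v v ≠ 0) :
    cnt (fun z => Iso q z ∧ herm q V z ≠ 0 ∧ B z z = 0) ≤
      ((q : ℤ) ^ 2 - 1) * (2 * q ^ 5 + q ^ 3 + 2 * q ^ 2) := by
  obtain ⟨k, hk, hqk⟩ := exists_q_eq (q := q) (F := F)
  have hJ := cnt_jset_of_iso hV0 hV
  have h1 := double_count (q := q) B V
  obtain ⟨v, hv, hBv⟩ := hB V hV0 hV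
  have h2 := cnt_jset_zero_le B hV0 hV hv hBv
  have h3 : (q : ℤ) ^ 2 * (∑ A, if Jset q V A then cval q B V A else 0) ≤
      cnt (Jset q V) * (2 * (q ^ 7 - q ^ 5)) +
        cnt (fun A => Jset q V A ∧ B A A = 0) * (2 * (q ^ 2 * (q ^ 4 - q ^ 2))) := by
    rw [← sum_ite_const_eq, ← sum_ite_const_eq, mul_sum, ← sum_add_distrib]
    refine sum_le_sum fun A _ => ?_
    by_cases h : Jset q V A
    · obtain ⟨v, hv, hBv⟩ := hB A (h.2.2.ne_zero 0) h.1
      have h4 := cval_le_of_iso B hV h hv hBv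
      have h5 : (0 : ℤ) ≤ q ^ 2 * (q ^ 4 - q ^ 2) := by
        rw [hqk]; ring_nf; positivity
      by_cases hBA : B A A = 0
      · simp only [h, hBA, and_self, if_true]
        have h6 : (quadForm B).wt q A ≤ 2 := by
          unfold Form.wt; split_ifs <;> norm_num
        nlinarith
      · simp only [h, hBA, and_false, if_true, if_false]
        have hw : (quadForm B).wt q A = 0 := if_neg hBA
        rw [hw] at h4
        linarith
    · simp [h]
  rw [hJ, ← h1] at h3
  have h4 := mul_le_mul_of_nonneg_right h2 (show (0 : ℤ) ≤ q ^ 2 * (q ^ 4 - q ^ 2) by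
    rw [hqk]; ring_nf; positivity)
  refine le_of_mul_le_mul_left (a := (q : ℤ) ^ 2 * ((q ^ 2 - 1) * (q ^ 3 + 1))) ?_ ?_
  · linarith
  · rw [hqk]; ring_nf; positivity

end Quadric

/-- Second moment bound for an incidence relation. -/
lemma sq_sum_cnt_le {α β : Type} [Fintype α] [Fintype β] (R : α → β → Prop) (Z : β → Prop)
    (hZ : ∀ a b, R a b → Z b) :
    (∑ a, cnt (R a)) ^ 2 ≤ cnt Z * ∑ a, ∑ a', cnt (fun b => R a b ∧ R a' b) := by
  have h1 : ∑ a, cnt (R a) = ∑ b ∈ univ.filter Z, cnt (fun a => R a b) := by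
    rw [sum_filter, sum_cnt_comm]
    refine sum_congr rfl fun b _ => ?_
    split_ifs with hb
    · rfl
    · rw [cnt_eq_sum]
      exact sum_eq_zero fun a _ => if_neg fun h => hb (hZ a b h)
  have h2 : ∑ a, ∑ a', cnt (fun b => R a b ∧ R a' b) = ∑ b, cnt (fun a => R a b) ^ 2 := by
    simp only [sq, cnt_eq_sum (fun a => R a _), sum_mul_sum]
    rw [eq_comm, sum_comm]
    refine sum_congr rfl fun a _ => ?_
    rw [sum_comm]
    refine sum_congr rfl fun a' _ => ?_
    rw [cnt_eq_sum]
    refine sum_congr rfl fun b _ => ?_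
    by_cases h : R a b <;> by_cases h' : R a' b <;> simp [h, h']
  rw [h1, h2]
  refine sq_sum_le_card_mul_sum_sq.trans ?_
  refine mul_le_mul_of_nonneg_left ?_ (cnt_nonneg Z)
  exact sum_le_sum_of_subset_of_nonneg (filter_subset _ _) fun _ _ _ => sq_nonneg _

section Cubic

variable {q : ℕ} {F : Type} [Field F] [Fintype F] [hq : HermField q F]
  (T : V5 F →ₗ[F] V5 F →ₗ[F] V5 F →ₗ[F] F)

/-- Regular zeros of the cubic with an exceptionally large bad locus. -/
def Exc (q : ℕ) {F : Type} [Field F] [Fintype F] (T : V5 F →ₗ[F] V5 F →ₗ[F] V5 F →ₗ[F] F)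
    (A : V5 F) : Prop :=
  A ≠ 0 ∧ Iso q A ∧ T A A A = 0 ∧ ¬ (cubicForm T).Sing q A ∧
    (q : ℤ) ^ 2 + 3 * (q ^ 4 - q ^ 2) < (cubicForm T).bad q ⊤ A

/-- The planes attached to exceptional zeros. -/
def ExcPlane (q : ℕ) {F : Type} [Field F] (T : V5 F →ₗ[F] V5 F →ₗ[F] V5 F →ₗ[F] F)
    (A b : V5 F) : Prop :=
  (cubicForm T).Reg q A b ∧ (∀ x ∈ perp q A ⊓ perp q b, T x x x = 0) ∧ ¬ Iso q b

lemma ExcPlane.mem {F : Type} [Field F] {T : V5 F →ₗ[F] V5 F →ₗ[F] V5 F →ₗ[F] F} {A b : V5 F}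
    (h : ExcPlane q T A b) : A ∈ perp q A ⊓ perp q b :=
  ⟨h.1.1, h.1.2.2.2.1⟩

include hq

variable {T} in
lemma Exc.exists_plane {A : V5 F} (h : Exc q T A) : ∃ b, ExcPlane q T A b := by
  obtain ⟨k, hk, hqk⟩ := exists_q_eq (q := q) (F := F)
  obtain ⟨hA0, hA, hf, hS, ha⟩ := h
  obtain ⟨b, hb⟩ := (cubicForm T).exists_reg hA0 hA hf hS
  refine ⟨b, hb, ?_, ?_⟩
  · intro x hx
    by_contra hfx
    have := (cubicForm T).bad_le_of_reg_of_ne le_rfl hb hx hfx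
    push_cast at this
    linarith
  · intro hI
    have h1 := (cubicForm T).bad_le_of_reg le_rfl hb
    rw [iso_perp_inf_gamma hA hI (herm_symm.1 hb.2.2.2.1) hb.2.2.2.2] at h1
    have h2 : (0 : ℤ) ≤ q ^ 2 + 3 * (q ^ 4 - q ^ 2) - q ^ 4 := by
      rw [hqk]; ring_nf; positivity
    linarith

variable {T}

lemma ExcPlane.finrank_eq {A b : V5 F} (h : ExcPlane q T A b) :
    finrank F (perp q A ⊓ perp q b : Submodule F (V5 F)) = 3 := finrank_perp_inf h.1.2.2.2.2

lemma ExcPlane.exists_smul {A b x : V5 F} (h : ExcPlane q T A b) (hx : x ∈ perp q A ⊓ perp q b)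
    (hr : ∀ y ∈ perp q A ⊓ perp q b, herm q x y = 0) : ∃ s : F, s • A = x := by
  obtain ⟨s, t, rfl⟩ := mem_span_pair_of_perp (q := q) (a := A) (b := b) (x := x)
    fun y h1 h2 => hr y ⟨h1, h2⟩
  have h1 : herm q b (s • A + t • b) = 0 := hx.2
  rw [map_add, map_smul, map_smul, h.1.2.2.2.1, smul_zero, zero_add, smul_eq_mul] at h1
  have h2 : t = 0 := (mul_eq_zero.1 h1).resolve_right h.2.2
  exact ⟨s, by rw [h2, zero_smul, add_zero]⟩

lemma ExcPlane.inter {A b A' b' : V5 F} (h : ExcPlane q T A b) (h' : ExcPlane q T A' b')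
    (hne : ¬ ∃ s : F, s • A = A') :
    cnt (fun x => x ∈ perp q A ⊓ perp q b ∧ x ∈ perp q A' ⊓ perp q b') ≤ (q : ℤ) ^ 4 := by
  have h1 := cnt_mem (q := q) ((perp q A ⊓ perp q b) ⊓ (perp q A' ⊓ perp q b'))
  have h2 : finrank F ((perp q A ⊓ perp q b) ⊓ (perp q A' ⊓ perp q b') :
      Submodule F (V5 F)) ≤ 2 := by
    by_contra hlt
    have e1 := Submodule.eq_of_le_of_finrank_le
      (inf_le_left : (perp q A ⊓ perp q b) ⊓ (perp q A' ⊓ perp q b') ≤ _) (by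
        rw [h.finrank_eq]; omega)
    have e2 := Submodule.eq_of_le_of_finrank_le
      (inf_le_right : (perp q A ⊓ perp q b) ⊓ (perp q A' ⊓ perp q b') ≤ _) (by
        rw [h'.finrank_eq]; omega)
    have e3 := e1.symm.trans e2
    refine hne (h.exists_smul (e3 ▸ h'.mem) fun y hy => ?_)
    rw [e3] at hy
    exact hy.1
  change cnt (fun x => x ∈ (perp q A ⊓ perp q b) ⊓ (perp q A' ⊓ perp q b')) ≤ _
  rw [h1]
  have h7 := q_ge (q := q) (F := F)
  exact pow_le_pow_right₀ (by linarith) (by omega)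

lemma cnt_zero_perp_le {c v : V5 F} (hc : c ≠ 0) (hv : herm q c v = 0) (hfv : T v v v ≠ 0) :
    cnt (fun x => herm q c x = 0 ∧ T x x x = 0) ≤ 3 * (q : ℤ) ^ 6 := by
  have h1 := (cubicForm T).schwartz_zippel (q := q) (perp q c) hv hfv
  rw [finrank_perp hc] at h1
  have h7 := q_ge (q := q) (F := F)
  refine le_of_mul_le_mul_left (a := (q : ℤ) ^ 2) ?_ (by positivity)
  refine h1.trans (le_of_eq ?_)
  push_cast
  ring

/-- Few exceptional planes pass through a point with nonzero differential. -/
lemma cnt_exc_through_le {β : V5 F → V5 F} (hβ : ∀ A, Exc q T A → ExcPlane q T A (β A))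
    (hT : ∀ a, a ≠ 0 → ∃ v, herm q a v = 0 ∧ T v v v ≠ 0) {z : V5 F}
    (hz : (cubicForm T).D z ≠ 0) :
    cnt (fun A => Exc q T A ∧ z ∈ perp q A ⊓ perp q (β A)) ≤ 4 * ((q : ℤ) ^ 2 - 1) := by
  obtain ⟨k, hk, hqk⟩ := exists_q_eq (q := q) (F := F)
  obtain ⟨c, hc⟩ := exists_herm_eq (q := q) ((cubicForm T).D z)
  have hc0 : c ≠ 0 := by
    rintro rfl
    exact hz (hc.trans (herm_eq_zero.2 rfl))
  obtain ⟨v, hv, hfv⟩ := hT c hc0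
  set K : V5 F → Prop := fun A => Exc q T A ∧ z ∈ perp q A ⊓ perp q (β A) with hK
  have h1 := sq_sum_cnt_le (fun A x => K A ∧ x ∈ perp q A ⊓ perp q (β A))
    (fun x => herm q c x = 0 ∧ T x x x = 0) (by
      rintro A x ⟨⟨hA, hzA⟩, hx⟩
      obtain ⟨-, h0, -⟩ := hβ A hA
      refine ⟨?_, h0 x hx⟩
      rw [← hc]
      refine (cubicForm T).D_eq_zero_of_bad (q := q) le_rfl fun s t => ?_
      exact h0 _ (Submodule.add_mem _ (Submodule.smul_mem _ s hzA) (Submodule.smul_mem _ t hx)))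
  have h2 : ∑ A, cnt (fun x => K A ∧ x ∈ perp q A ⊓ perp q (β A)) = cnt K * (q : ℤ) ^ 6 := by
    rw [← sum_ite_const_eq]
    refine sum_congr rfl fun A _ => ?_
    by_cases hA : K A
    · simp only [hA, true_and, if_true]
      rw [cnt_mem (q := q), (hβ A hA.1).finrank_eq]
    · simp [hA, cnt]
  have h3 : ∑ A, ∑ A', cnt (fun x => (K A ∧ x ∈ perp q A ⊓ perp q (β A)) ∧
      (K A' ∧ x ∈ perp q A' ⊓ perp q (β A'))) ≤ cnt K * (cnt K * (q : ℤ) ^ 4 + q ^ 2 * q ^ 6) := by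
    rw [← sum_ite_const_eq]
    refine sum_le_sum fun A _ => ?_
    split_ifs with hA
    · rw [← cnt_span_singleton (q := q) hA.1.1, ← sum_ite_const_eq, ← sum_ite_const_eq,
        ← sum_add_distrib]
      refine sum_le_sum fun A' _ => ?_
      by_cases hA' : K A'
      · simp only [hA, hA', true_and, if_true]
        split_ifs with hp
        · have h4 : cnt (fun x => x ∈ perp q A ⊓ perp q (β A) ∧ x ∈ perp q A' ⊓ perp q (β A')) ≤
              cnt (fun x => x ∈ perp q A ⊓ perp q (β A)) := cnt_mono fun x hx => hx.1
          rw [cnt_mem (q := q), (hβ A hA.1).finrank_eq, show 2 * 3 = 6 from rfl] at h4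
          have : (0 : ℤ) ≤ q ^ 4 := by positivity
          linarith
        · rw [add_zero]
          exact (hβ A hA.1).inter (hβ A' hA'.1) hp
      · simp only [hA', false_and, and_false, if_false]
        have : cnt (fun _ : V5 F => False) = 0 := by simp [cnt]
        rw [this]
        split_ifs <;> positivity
    · simp [hA, cnt]
  have h4 := cnt_zero_perp_le hc0 hv hfv
  rw [h2] at h1
  have h5 := h1.trans (mul_le_mul h4 h3 (sum_nonneg fun _ _ => sum_nonneg fun _ _ => cnt_nonneg _)
    (by positivity))
  have h6 := cnt_nonneg K
  rcases h6.eq_or_lt with h6 | h6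
  · rw [← h6, hqk]; ring_nf; positivity
  have h7 : cnt K * ((q : ℤ) ^ 2 - 3) ≤ 3 * q ^ 4 := by
    refine le_of_mul_le_mul_left (a := cnt K * (q : ℤ) ^ 10) ?_ ?_
    · linarith
    · rw [hqk]; positivity
  have h8 : (0 : ℤ) < q ^ 2 - 3 := by
    rw [hqk]; ring_nf; positivity
  refine le_of_mul_le_mul_right (a := (q : ℤ) ^ 2 - 3) ?_ h8
  refine h7.trans ?_
  rw [hqk, ← sub_nonneg]; ring_nf; positivity

lemma ExcPlane.le_cnt_D_ne_zero {A b : V5 F} (h : ExcPlane q T A b) :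
    (q : ℤ) ^ 6 - 2 * q ^ 4 ≤
      cnt (fun z => z ∈ perp q A ⊓ perp q b ∧ (cubicForm T).D z ≠ 0) := by
  have h7 := q_ge (q := q) (F := F)
  have hb : b ≠ 0 := by
    rintro rfl
    exact h.2.2 (iso_zero q)
  obtain ⟨y, hy⟩ := exists_herm_ne_zero (q := q) hb
  let B : V5 F →ₗ[F] V5 F →ₗ[F] F := LinearMap.mk₂ F
    (fun z w => T z w y + T z y w + T y z w)
    (by intros; simp; ring) (by intros; simp; ring) (by intros; simp; ring) (by intros; simp; ring)
  have hB : ∀ z, B z z = (cubicForm T).D z y := fun z => rfl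
  have h1 := (quadForm B).schwartz_zippel (q := q) (perp q A ⊓ perp q b) h.mem (by
    change B A A ≠ 0
    rw [hB, h.1.2.2.1]
    exact hy)
  rw [h.finrank_eq] at h1
  have h2 := cnt_split (fun x => x ∈ perp q A ⊓ perp q b) (fun z => (quadForm B).f z = 0)
  rw [cnt_mem (q := q), h.finrank_eq, show 2 * 3 = 6 from rfl] at h2
  have h3 : cnt (fun z => z ∈ perp q A ⊓ perp q b ∧ ¬ (quadForm B).f z = 0) ≤
      cnt (fun z => z ∈ perp q A ⊓ perp q b ∧ (cubicForm T).D z ≠ 0) := by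
    refine cnt_mono fun z hz => ⟨hz.1, fun h0 => hz.2 ?_⟩
    change B z z = 0
    rw [hB, h0]
    rfl
  have h4 : cnt (fun z => z ∈ perp q A ⊓ perp q b ∧ (quadForm B).f z = 0) ≤ 2 * (q : ℤ) ^ 4 := by
    refine le_of_mul_le_mul_left (a := (q : ℤ) ^ 2) ?_ (by positivity)
    refine h1.trans (le_of_eq ?_)
    push_cast
    ring
  linarith

lemma cnt_exc_le (hT : ∀ a, a ≠ 0 → ∃ v, herm q a v = 0 ∧ T v v v ≠ 0) {v : V5 F}
    (hv : T v v v ≠ 0) : cnt (Exc q T) * ((q : ℤ) ^ 2 - 2) ≤ 12 * q ^ 4 * (q ^ 2 - 1) := by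
  have h7 := q_ge (q := q) (F := F)
  have hex : ∀ A, ∃ b, Exc q T A → ExcPlane q T A b := by
    intro A
    by_cases h : Exc q T A
    · obtain ⟨b, hb⟩ := h.exists_plane
      exact ⟨b, fun _ => hb⟩
    · exact ⟨0, fun h' => absurd h' h⟩
  choose β hβ using hex
  have h1 : cnt (Exc q T) * ((q : ℤ) ^ 6 - 2 * q ^ 4) ≤ ∑ A, cnt (fun z => Exc q T A ∧
      (z ∈ perp q A ⊓ perp q (β A) ∧ (cubicForm T).D z ≠ 0)) := by
    rw [← sum_ite_const_eq]
    refine sum_le_sum fun A _ => ?_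
    split_ifs with hA
    · simp only [hA, true_and]
      exact (hβ A hA).le_cnt_D_ne_zero
    · exact cnt_nonneg _
  have h2 : ∑ z, cnt (fun A => Exc q T A ∧ (z ∈ perp q A ⊓ perp q (β A) ∧
      (cubicForm T).D z ≠ 0)) ≤ cnt (fun z => T z z z = 0) * (4 * ((q : ℤ) ^ 2 - 1)) := by
    rw [← sum_ite_const_eq]
    refine sum_le_sum fun z _ => ?_
    by_cases hz : T z z z = 0 ∧ (cubicForm T).D z ≠ 0
    · rw [if_pos hz.1]
      refine (cnt_mono fun A hA => ?_).trans (cnt_exc_through_le hβ hT hz.2)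
      exact ⟨hA.1, hA.2.1⟩
    · have : cnt (fun A => Exc q T A ∧ (z ∈ perp q A ⊓ perp q (β A) ∧
          (cubicForm T).D z ≠ 0)) = 0 := by
        rw [cnt_eq_sum]
        refine sum_eq_zero fun A _ => if_neg ?_
        rintro ⟨h3, h4, h5⟩
        exact hz ⟨(hβ A h3).2.1 z h4, h5⟩
      rw [this]
      split_ifs
      · nlinarith
      · exact le_rfl
  have h3 : cnt (fun z => T z z z = 0) ≤ 3 * (q : ℤ) ^ 8 := by
    have h4 := (cubicForm T).schwartz_zippel (q := q) ⊤ trivial hv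
    rw [finrank_top, finrank_fin_fun] at h4
    refine le_of_mul_le_mul_left (a := (q : ℤ) ^ 2) ?_ (by positivity)
    refine le_trans (mul_le_mul_of_nonneg_left (cnt_mono fun z hz => ⟨trivial, hz⟩)
      (by positivity)) (h4.trans (le_of_eq ?_))
    push_cast
    ring
  rw [sum_cnt_comm] at h1
  have h5 := mul_le_mul_of_nonneg_right h3 (show (0 : ℤ) ≤ 4 * (q ^ 2 - 1) by nlinarith)
  refine le_of_mul_le_mul_left (a := (q : ℤ) ^ 4) ?_ (by positivity)
  linarith

/-- Lower bound for the contribution of a zero to the weighted sum. -/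
lemma le_wt_mul {A v : V5 F} (hA0 : A ≠ 0) (hA : Iso q A) (hf : T A A A = 0)
    (hv : herm q A v = 0) (hfv : T v v v ≠ 0) :
    ((q : ℤ) ^ 3 - 2) * (q ^ 4 - q ^ 2) - (if Exc q T A then (q - 2) * ((q : ℤ) ^ 4 - q ^ 2) else 0) ≤
      (cubicForm T).wt q A * (q ^ 7 - q ^ 5 + q ^ 4 - (cubicForm T).bad q ⊤ A) := by
  obtain ⟨k, hk, hqk⟩ := exists_q_eq (q := q) (F := F)
  by_cases hS : (cubicForm T).Sing q A
  · rw [(cubicForm T).wt_of_sing hf hS, if_neg fun h => h.2.2.2.1 hS]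
    have h1 : (cubicForm T).bad q ⊤ A ≤ 3 * (q : ℤ) ^ 6 := by
      refine (cnt_mono fun z hz => ?_).trans (cnt_zero_perp_le hA0 hv hfv)
      refine ⟨hz.1.2, ?_⟩
      have := hz.2.2 0 1
      rwa [zero_smul, one_smul, zero_add] at this
    have h2 : (0 : ℤ) ≤ 2 * (q ^ 7 - q ^ 5 + q ^ 4 - 3 * q ^ 6) -
        (q ^ 3 - 2) * (q ^ 4 - q ^ 2) := by
      rw [hqk]; ring_nf; positivity
    linarith
  · rw [(cubicForm T).wt_of_not_sing hf hS]
    split_ifs with hE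
    · obtain ⟨b, hb⟩ := (cubicForm T).exists_reg hA0 hA hf hS
      have h1 := ((cubicForm T).bad_le_of_reg le_rfl hb).trans
        (iso_perp_inf_le hA hb.2.2.2.1 hb.2.2.2.2)
      linarith
    · have h1 : (cubicForm T).bad q ⊤ A ≤ (q : ℤ) ^ 2 + 3 * (q ^ 4 - q ^ 2) := by
        by_contra hlt
        exact hE ⟨hA0, hA, hf, hS, not_le.1 hlt⟩
      linarith

/-- The case of a cubic containing no hyperplane. -/
lemma cubic_no_hyperplane (hT : ∀ a, a ≠ 0 → ∃ v, herm q a v = 0 ∧ T v v v ≠ 0) {v : V5 F}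
    (hv : T v v v ≠ 0) :
    cnt (fun x => x ≠ 0 ∧ Iso q x ∧ T x x x = 0) ≤
      ((q : ℤ) ^ 2 - 1) * (3 * q ^ 5 + q ^ 3 + 3 * q ^ 2 + 1) := by
  obtain ⟨k, hk, hqk⟩ := exists_q_eq (q := q) (F := F)
  have h1 := (cubicForm T).weighted_le (q := q) (by norm_num) ⊤ (q ^ 7 - q ^ 5 + q ^ 4)
    fun x _ hx0 hxI => by rw [top_inf_eq]; exact iso_perp_of_iso hx0 hxI
  rw [cnt_iso_ne_zero, iso_top] at h1
  have h2 : cnt (fun x => x ≠ 0 ∧ Iso q x ∧ T x x x = 0) * (((q : ℤ) ^ 3 - 2) * (q ^ 4 - q ^ 2)) -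
      cnt (Exc q T) * ((q - 2) * (q ^ 4 - q ^ 2)) ≤
      ∑ x : V5 F, (if x ∈ (⊤ : Submodule F (V5 F)) ∧ x ≠ 0 ∧ Iso q x then
        (cubicForm T).wt q x * (q ^ 7 - q ^ 5 + q ^ 4 - (cubicForm T).bad q ⊤ x) else 0) := by
    rw [← sum_ite_const_eq, ← sum_ite_const_eq, ← sum_sub_distrib]
    refine sum_le_sum fun A _ => ?_
    by_cases hA : A ≠ 0 ∧ Iso q A
    · rw [if_pos (show A ∈ ⊤ ∧ A ≠ 0 ∧ Iso q A from ⟨trivial, hA⟩)]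
      by_cases hf : T A A A = 0
      · rw [if_pos ⟨hA.1, hA.2, hf⟩]
        obtain ⟨v, hv, hfv⟩ := hT A hA.1
        exact le_wt_mul hA.1 hA.2 hf hv hfv
      · have hw : (cubicForm T).wt q A = 0 := if_neg hf
        rw [if_neg fun h => hf h.2.2, if_neg fun h : Exc q T A => hf h.2.2.1, hw]
        simp
    · rw [if_neg fun h => hA ⟨h.1, h.2.1⟩, if_neg fun h : Exc q T A => hA ⟨h.1, h.2.1⟩,
        if_neg fun h => hA h.2]
      simp
  have h3 := cnt_exc_le hT hv
  set X := cnt (fun x => x ≠ 0 ∧ Iso q x ∧ T x x x = 0)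
  set E := cnt (Exc q T)
  have h4 := (mul_le_mul_of_nonneg_left h2 (show (0 : ℤ) ≤ q ^ 2 + 1 by positivity)).trans h1
  have h5 : X * (q ^ 3 - 2) - E * (q - 2) ≤ 3 * (q ^ 5 + 1) * (q ^ 2 - 1) * (q ^ 3 + 1) := by
    refine le_of_mul_le_mul_left (a := ((q : ℤ) ^ 2 + 1) * (q ^ 4 - q ^ 2)) ?_ ?_
    · push_cast at h4
      linarith
    · rw [hqk]; ring_nf; positivity
  have h6 := mul_le_mul_of_nonneg_left h5 (show (0 : ℤ) ≤ q ^ 2 - 2 by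
    rw [hqk]; ring_nf; positivity)
  have h7 := mul_le_mul_of_nonneg_left h3 (show (0 : ℤ) ≤ q - 2 by rw [hqk]; ring_nf; positivity)
  have h8 : (0 : ℤ) ≤ (q ^ 2 - 1) * ((q ^ 2 - 2) * (q ^ 6 - 6 * q ^ 5 - 4 * q ^ 3 - 6 * q ^ 2 - 5) -
      12 * q ^ 5 + 24 * q ^ 4) := by
    rw [hqk]; ring_nf; positivity
  refine le_of_mul_le_mul_left (a := ((q : ℤ) ^ 3 - 2) * (q ^ 2 - 2)) ?_ ?_
  · linarith
  · rw [hqk]; ring_nf; positivity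

end Cubic

section Split

variable {q : ℕ} {F : Type} [Field F] [Fintype F] {T : V5 F →ₗ[F] V5 F →ₗ[F] V5 F →ₗ[F] F}

lemma cubic_cnt_le_add {a : V5 F} {B : V5 F →ₗ[F] V5 F →ₗ[F] F}
    (hB : ∀ x, T x x x = herm q a x * B x x) :
    cnt (fun x => x ≠ 0 ∧ Iso q x ∧ T x x x = 0) ≤
      (iso q (perp q a) - 1) + cnt (fun z => Iso q z ∧ herm q a z ≠ 0 ∧ B z z = 0) := by
  rw [← cnt_iso_ne_zero]
  refine le_trans (cnt_mono fun x hx => ?_) (cnt_or_le _ _)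
  obtain ⟨h1, h2, h3⟩ := hx
  rw [hB, mul_eq_zero] at h3
  by_cases h : herm q a x = 0
  · exact Or.inl ⟨h, h1, h2⟩
  · exact Or.inr ⟨h2, h, h3.resolve_left h⟩

end Split

section Cubic

variable {q : ℕ} {F : Type} [Field F] [Fintype F] [hq : HermField q F]
  {T : V5 F →ₗ[F] V5 F →ₗ[F] V5 F →ₗ[F] F}

include hq

lemma exists_herm_eq_one {a : V5 F} (ha : a ≠ 0) : ∃ v, herm q a v = 1 := by
  obtain ⟨v, hv⟩ := exists_herm_ne_zero (q := q) ha
  exact ⟨(herm q a v)⁻¹ • v, by rw [map_smul, smul_eq_mul, inv_mul_cancel₀ hv]⟩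

/-- A cubic meets the Hermitian threefold in at most as many points as the extremal union of three
hyperplanes. -/
theorem cubic_cnt_le {w : V5 F} (hw : T w w w ≠ 0) :
    cnt (fun x => x ≠ 0 ∧ Iso q x ∧ T x x x = 0) ≤
      ((q : ℤ) ^ 2 - 1) * (3 * q ^ 5 + q ^ 3 + 3 * q ^ 2 + 1) := by
  by_cases h1 : ∃ V : V5 F, V ≠ 0 ∧ Iso q V ∧ ∀ x, herm q V x = 0 → T x x x = 0
  · obtain ⟨V, hV0, hV, hVT⟩ := h1
    obtain ⟨v, hv⟩ := exists_herm_eq_one (q := q) hV0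
    obtain ⟨B, hB⟩ := cubic_factor T (herm q V) hv hVT
    by_cases h2 : ∃ W : V5 F, W ≠ 0 ∧ Iso q W ∧ ∀ x, herm q W x = 0 → B x x = 0
    · obtain ⟨W, hW0, hW, hWB⟩ := h2
      obtain ⟨u, hu⟩ := exists_herm_eq_one (q := q) hW0
      obtain ⟨m, hm⟩ := quad_factor B ⊤ (herm q W) (Submodule.mem_top (x := u)) hu
        fun x _ hx => hWB x hx
      obtain ⟨c, rfl⟩ := exists_herm_eq (q := q) m
      have hc : c ≠ 0 := by
        rintro rfl
        apply hw
        rw [hB, hm w trivial, herm_zero_right, mul_zero, mul_zero]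
      have h3 := three_hyperplanes hV0 hV hW0 hW hc
      have h4 : cnt (fun x => x ≠ 0 ∧ Iso q x ∧ T x x x = 0) + cnt (fun x : V5 F => x = 0) ≤
          cnt (fun x => Iso q x ∧ herm q V x * (herm q W x * herm q c x) = 0) := by
        rw [cnt_split (fun x => Iso q x ∧ _) (fun x => x = 0), add_comm]
        refine add_le_add (cnt_mono ?_) (cnt_mono ?_)
        · rintro _ rfl
          exact ⟨⟨iso_zero q, by rw [map_zero, zero_mul]⟩, rfl⟩
        · rintro x ⟨h5, h6, h7⟩
          rw [hB, hm x trivial] at h7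
          exact ⟨⟨h6, h7⟩, h5⟩
      rw [cnt_eq_one] at h4
      linarith
    · push Not at h2
      have h3 := cubic_cnt_le_add (q := q) hB
      rw [iso_perp_of_iso hV0 hV] at h3
      have h4 := quadric_off_iso B hV0 hV h2
      linarith
  · push Not at h1
    by_cases h2 : ∃ a : V5 F, a ≠ 0 ∧ ∀ x, herm q a x = 0 → T x x x = 0
    · obtain ⟨a, ha0, haT⟩ := h2
      have ha : ¬ Iso q a := by
        intro ha
        obtain ⟨x, hx, hx'⟩ := h1 a ha0 ha
        exact hx' (haT x hx)
      obtain ⟨v, hv⟩ := exists_herm_eq_one (q := q) ha0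
      obtain ⟨B, hB⟩ := cubic_factor T (herm q a) hv haT
      have h3 := cubic_cnt_le_add (q := q) hB
      rw [iso_perp_of_not_iso ha] at h3
      have h4 := quadric_off_not_iso B ha fun A hA0 hA => by
        obtain ⟨x, hx, hx'⟩ := h1 A hA0 hA
        refine ⟨x, hx, fun h => hx' ?_⟩
        rw [hB, h, mul_zero]
      linarith
    · push Not at h2
      exact cubic_no_hyperplane h2 hw

end Cubic

section Trilinear

variable {F : Type} [Field F]

lemma exists_trilinear_monomial (c : F) (m : Fin 5 →₀ ℕ) (hm : m.degree = 3) :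
    ∃ T : V5 F →ₗ[F] V5 F →ₗ[F] V5 F →ₗ[F] F, ∀ x, T x x x = eval x (monomial m c) := by
  have h : Multiset.card (Finsupp.toMultiset m) = 3 := by
    rw [Finsupp.card_toMultiset, ← hm]; rfl
  obtain ⟨i, j, k, h⟩ := Multiset.card_eq_three.1 h
  refine ⟨(c • LinearMap.proj i).smulRight ((LinearMap.proj j).smulRight (LinearMap.proj k)),
    fun x => ?_⟩
  have h2 : m.prod (fun i e => x i ^ e) = ((Finsupp.toMultiset m).map x).prod := by
    rw [Finsupp.toMultiset_map, Finsupp.prod_toMultiset]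
    exact (Finsupp.prod_mapDomain_index (by simp) (by simp [pow_add])).symm
  rw [eval_monomial, h2, h]
  simp
  ring

lemma exists_trilinear {G : MvPolynomial (Fin 5) F} (hG : G.IsHomogeneous 3) :
    ∃ T : V5 F →ₗ[F] V5 F →ₗ[F] V5 F →ₗ[F] F, ∀ x, T x x x = eval x G := by
  have h : ∀ m, ∃ T : V5 F →ₗ[F] V5 F →ₗ[F] V5 F →ₗ[F] F, m ∈ G.support →
      ∀ x, T x x x = eval x (monomial m (G.coeff m)) := by
    intro m
    by_cases hm : m ∈ G.support
    · obtain ⟨T, hT⟩ := exists_trilinear_monomial (G.coeff m) m (by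
        have := hG (mem_support_iff.1 hm)
        rw [Finsupp.degree_eq_weight_one]
        exact this)
      exact ⟨T, fun _ => hT⟩
    · exact ⟨0, fun h => absurd h hm⟩
  choose T hT using h
  refine ⟨∑ m ∈ G.support, T m, fun x => ?_⟩
  conv_rhs => rw [G.as_sum, map_sum]
  rw [LinearMap.sum_apply, LinearMap.sum_apply, LinearMap.sum_apply]
  exact sum_congr rfl fun m hm => hT m hm x

end Trilinear

section Projective

variable {F : Type} [Field F] [Fintype F]

lemma ncard_mul_le (P : V5 F → Prop) (hP : ∀ (c : F) x, P x → P (c • x)) :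
    (({x : P4 F | P x.rep}.ncard : ℕ) : ℤ) * (Fintype.card F - 1) ≤
      cnt (fun x : V5 F => x ≠ 0 ∧ P x) := by
  let f : {x : P4 F | P x.rep} × Fˣ → {x : V5 F // x ≠ 0 ∧ P x} := fun p =>
    ⟨p.2 • p.1.1.rep, by
      rw [ne_eq, smul_eq_zero_iff_eq]
      exact p.1.1.rep_nonzero, hP p.2 _ p.1.2⟩
  have hf : Function.Injective f := by
    rintro ⟨⟨x, hx⟩, u⟩ ⟨⟨y, hy⟩, u'⟩ h
    have h : u • x.rep = u' • y.rep := congrArg Subtype.val h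
    have hxy : x = y := by
      rw [← x.mk_rep, ← y.mk_rep, Projectivization.mk_eq_mk_iff]
      refine ⟨u⁻¹ * u', ?_⟩
      rw [mul_smul, ← h, inv_smul_smul]
    subst hxy
    have : u = u' := by
      ext
      exact smul_left_injective F x.rep_nonzero h
    rw [this]
  have h := Nat.card_le_card_of_injective f hf
  rw [Nat.card_prod, Nat.card_coe_set_eq, Nat.card_eq_fintype_card (α := Fˣ),
    Nat.card_eq_fintype_card, Fintype.card_units, Fintype.card_subtype] at h
  have h1 : 1 ≤ Fintype.card F := Fintype.card_pos
  unfold cnt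
  zify [h1] at h
  convert h

lemma hermField_of_card {q : ℕ} (hq : IsPrimePow q) (hq7 : 7 ≤ q)
    (hF : Fintype.card F = q ^ 2) : HermField q F := by
  obtain ⟨p, k, hp, hk, rfl⟩ := (isPrimePow_nat_iff q).1 hq
  obtain ⟨r, hr⟩ := CharP.exists F
  obtain ⟨n, hrp, hn⟩ := FiniteField.card F r
  have hrp' : r = p := by
    refine (Nat.prime_dvd_prime_iff_eq hrp hp).1 (hrp.dvd_of_dvd_pow (n := k * 2) ?_)
    rw [pow_mul, ← hF, hn]
    exact dvd_pow_self r n.ne_zero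
  subst hrp'
  have := Fact.mk hrp
  exact ⟨hF, fun x y => add_pow_char_pow x y _ _, hq7⟩

end Projective

end HermitianCubic

theorem stmt0 (q : ℕ) (hq : IsPrimePow q) (hq7 : 7 ≤ q)
    (F : Type) [Field F] [Fintype F] (hF : Fintype.card F = q ^ 2)
    (G : MvPolynomial (Fin 5) F) (hG : G ≠ 0) (hGd : G.IsHomogeneous 3) :
    (VG G ∩ hermV3 q F).ncard ≤ 3 * (q ^ 5 + q ^ 2) + q ^ 3 + 1 := by
  have := HermitianCubic.hermField_of_card hq hq7 hF
  obtain ⟨T, hT⟩ := HermitianCubic.exists_trilinear hGd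
  have hw : ∃ w, T w w w ≠ 0 := by
    by_contra! h
    refine hG (hGd.eq_zero_of_forall_eval_eq_zero_of_le_card (fun x => by rw [← hT, h]) ?_)
    rw [Cardinal.mk_fintype, hF]
    exact_mod_cast (by nlinarith : 3 ≤ q ^ 2)
  obtain ⟨w, hw⟩ := hw
  have h1 := HermitianCubic.cubic_cnt_le (q := q) hw
  have h2 := HermitianCubic.ncard_mul_le (fun x : Fin 5 → F => HermitianCubic.Iso q x ∧ T x x x = 0)
    fun c x hx => ⟨HermitianCubic.iso_smul c hx.1, by simp [hx.2]⟩
  have h3 : {x : P4 F | HermitianCubic.Iso q x.rep ∧ T x.rep x.rep x.rep = 0} =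
      VG G ∩ hermV3 q F := by
    ext x
    have h4 : HermitianCubic.Iso q x.rep ↔ ∑ i, x.rep i ^ (q + 1) = 0 := by
      simp only [HermitianCubic.Iso, HermitianCubic.herm, LinearMap.coe_mk, AddHom.coe_mk, pow_succ']
    simp only [VG, hermV3, Set.mem_inter_iff, Set.mem_ofPred_eq, ← hT, h4]
    exact and_comm
  rw [h3, hF] at h2
  have h5 := h2.trans h1
  have h6 : (0 : ℤ) < q ^ 2 - 1 := by
    have : (7 : ℤ) ≤ q := by exact_mod_cast hq7
    nlinarith
  push_cast at h5
  rw [mul_comm] at h5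
  have h7 := le_of_mul_le_mul_left h5 h6
  zify
  linarith
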